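/- arXiv:1908.06313 — 4 statements merged into one kernel-verified Lean document; each statement's English description precedes it below -/
import Mathlib

section
/- Let I : (0,∞) → (0,∞) be non-decreasing and let ‖·‖_X and ‖·‖_Y be rearrangement-invariant Banach function norms on measurable functions on (0,∞). Then the following are equivalent: (1) there exists a constant C such that ‖∫_t^∞ f(s)/I(s) ds‖_Y ≤ C ‖f‖_X for all non-negative f with ‖f‖_X < ∞; (2) there exists a constant C' such that ‖∫_t^∞ f(s)/I(s) ds‖_Y ≤ C' ‖f‖_X for all non-increasing non-negative f with ‖f‖_X < ∞. Moreover, if (2) holds with constant C', then (1) holds with C = 4C'. -/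
open MeasureTheory Set Filter
open scoped ENNReal NNReal Topology

noncomputable section

/-- The distribution function of `f`, viewed as a function on `(0,∞)` with Lebesgue measure:
`μ_f(s) = λ({t ∈ (0,∞) : f(t) > s})`. -/
def distrib (f : ℝ → ℝ≥0∞) (s : ℝ≥0∞) : ℝ≥0∞ :=
  volume {t : ℝ | t ∈ Set.Ioi (0 : ℝ) ∧ s < f t}

/-- The non-increasing rearrangement `f*(t) = inf { s ≥ 0 : μ_f(s) ≤ t }`. -/
def rearr (f : ℝ → ℝ≥0∞) (t : ℝ) : ℝ≥0∞ :=
  sInf {s : ℝ≥0∞ | distrib f s ≤ ENNReal.ofReal t}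

/-- The operator `R_I f(t) = (1/I(t)) ∫_0^t f(s) ds`. -/
def RI (I : ℝ → ℝ) (f : ℝ → ℝ≥0∞) : ℝ → ℝ≥0∞ :=
  fun t => (∫⁻ s in Set.Ioc (0 : ℝ) t, f s) / ENNReal.ofReal (I t)

/-- The operator `H_I f(t) = ∫_t^∞ f(s)/I(s) ds`. -/
def HI (I : ℝ → ℝ) (f : ℝ → ℝ≥0∞) : ℝ → ℝ≥0∞ :=
  fun t => ∫⁻ s in Set.Ioi t, f s / ENNReal.ofReal (I s)

/-- `G_I^m f(t) = sup_{s ≥ t} R_I^m f*(s)`. -/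
def GI (I : ℝ → ℝ) (m : ℕ) (f : ℝ → ℝ≥0∞) : ℝ → ℝ≥0∞ :=
  fun t => ⨆ s ∈ Set.Ici t, (RI I)^[m] (rearr f) s

/-- `Φ_I^m(t,s) = (∫_s^t 1/I(τ) dτ)^(m-1) / I(t)`. -/
def Phi (I : ℝ → ℝ) (m : ℕ) (t s : ℝ) : ℝ :=
  (∫ τ in s..t, 1 / I τ) ^ (m - 1) / I t

/-- `Φ_I^m(t,s)` is essentially decreasing in `t`. -/
def EssentiallyDecreasingIn (I : ℝ → ℝ) (m : ℕ) : Prop :=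
  ∀ s₀ ∈ Set.Ioi (0 : ℝ), ∃ t₀ ∈ Set.Ioi (0 : ℝ), ∀ t ∈ Set.Ioi t₀,
    ∃ rt ∈ Set.Ioi (0 : ℝ), ∀ r ∈ Set.Ioi rt, ∀ s ∈ Set.Ioo (0 : ℝ) s₀,
      Phi I m r s ≤ Phi I m t s

/-- The kernel operator `f ↦ (t ↦ ∫_t^∞ (f(s)/I(s)) (∫_t^s 1/I(r) dr)^(m-1) ds)`. -/
def kernelOp (I : ℝ → ℝ) (m : ℕ) (f : ℝ → ℝ≥0∞) : ℝ → ℝ≥0∞ :=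
  fun t => ∫⁻ s in Set.Ioi t,
    (f s / ENNReal.ofReal (I s)) * (ENNReal.ofReal (∫ r in t..s, 1 / I r)) ^ (m - 1)

/-- A Banach function norm on (non-negative) measurable functions on `(0,∞)`
(with Lebesgue measure). -/
structure BanachFunctionNorm where
  /-- The norm functional. -/
  N : (ℝ → ℝ≥0∞) → ℝ≥0∞
  /-- Positive homogeneity. -/
  smul : ∀ (c : ℝ≥0) (f : ℝ → ℝ≥0∞), Measurable f →
    N (fun t => (c : ℝ≥0∞) * f t) = (c : ℝ≥0∞) * N f
  /-- The norm vanishes exactly on a.e.-zero functions. -/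
  eq_zero_iff : ∀ f : ℝ → ℝ≥0∞, Measurable f →
    (N f = 0 ↔ ∀ᵐ t ∂(volume.restrict (Set.Ioi (0 : ℝ))), f t = 0)
  /-- Subadditivity. -/
  add_le : ∀ f g : ℝ → ℝ≥0∞, Measurable f → Measurable g →
    N (fun t => f t + g t) ≤ N f + N g
  /-- The lattice property. -/
  mono : ∀ f g : ℝ → ℝ≥0∞, Measurable f → Measurable g →
    (∀ᵐ t ∂(volume.restrict (Set.Ioi (0 : ℝ))), f t ≤ g t) → N f ≤ N g
  /-- The Fatou property: `f_n ↑ f` a.e. implies `‖f_n‖ ↑ ‖f‖`. -/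
  fatou : ∀ (f : ℕ → ℝ → ℝ≥0∞) (g : ℝ → ℝ≥0∞), (∀ n, Measurable (f n)) →
    Measurable g →
    (∀ᵐ t ∂(volume.restrict (Set.Ioi (0 : ℝ))), Monotone fun n => f n t) →
    (∀ᵐ t ∂(volume.restrict (Set.Ioi (0 : ℝ))), g t = ⨆ n, f n t) →
    N g = ⨆ n, N (f n)
  /-- Characteristic functions of sets of finite measure have finite norm. -/
  indicator_lt_top : ∀ E : Set ℝ, MeasurableSet E → E ⊆ Set.Ioi (0 : ℝ) →
    volume E < ∞ → N (E.indicator 1) < ∞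
  /-- Local embedding into `L¹`. -/
  exists_integral_le : ∀ E : Set ℝ, MeasurableSet E → E ⊆ Set.Ioi (0 : ℝ) →
    volume E < ∞ → ∃ C : ℝ≥0∞, C ≠ ∞ ∧
      ∀ f : ℝ → ℝ≥0∞, Measurable f → ∫⁻ t in E, f t ≤ C * N f

/-- A rearrangement-invariant Banach function norm: equimeasurable functions have
equal norms. -/
structure RIBanachFunctionNorm extends BanachFunctionNorm where
  /-- Rearrangement invariance. -/
  ri : ∀ f g : ℝ → ℝ≥0∞, Measurable f → Measurable g →
    (∀ s, distrib f s = distrib g s) → N f = N g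

/-- The associate norm `‖f‖_{X'} = sup { ∫_0^∞ |f g| : ‖g‖_X ≤ 1 }`. -/
def assocNorm (X : RIBanachFunctionNorm) (f : ℝ → ℝ≥0∞) : ℝ≥0∞ :=
  ⨆ (g : ℝ → ℝ≥0∞) (_ : Measurable g) (_ : X.N g ≤ 1),
    ∫⁻ t in Set.Ioi (0 : ℝ), f t * g t

/-- The down-associate norm `‖f‖_{X'_d} = sup { ∫_0^∞ |f| g* : ‖g‖_X ≤ 1 }`. -/
def downAssocNorm (X : RIBanachFunctionNorm) (f : ℝ → ℝ≥0∞) : ℝ≥0∞ :=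
  ⨆ (g : ℝ → ℝ≥0∞) (_ : Measurable g) (_ : X.N g ≤ 1),
    ∫⁻ t in Set.Ioi (0 : ℝ), f t * rearr g t

/-- Replace the entries of `c` with indices in `[a, a + L)` by their average. -/
def blockAvg (a L : ℕ) (c : ℕ → ℝ≥0∞) (k : ℕ) : ℝ≥0∞ :=
  if a ≤ k ∧ k < a + L then (∑ i ∈ Finset.range L, c (a + i)) / L else c k

/-- The reflection of the cyclic block `[a, a + L)` sending `a` to `a + j`. -/
def blockReflect (a L j k : ℕ) : ℕ :=
  if a ≤ k ∧ k < a + L ∧ j < L then (if k ≤ a + j then a + (a + j - k) else a + (a + j + L - k))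
  else k

theorem blockReflect_involutive (a L j : ℕ) : Function.Involutive (blockReflect a L j) := by
  intro k
  unfold blockReflect
  split_ifs <;> omega

theorem sum_blockReflect (a L k : ℕ) (c : ℕ → ℝ≥0∞) (hk : a ≤ k ∧ k < a + L) :
    ∑ j ∈ Finset.range L, c (blockReflect a L j k) = ∑ i ∈ Finset.range L, c (a + i) := by
  refine Finset.sum_nbij' (fun j => blockReflect a L j k - a)
    (fun i => if i + (k - a) < L then i + (k - a) else i + (k - a) - L) ?_ ?_ ?_ ?_ ?_
  all_goals intro j hj
  all_goals simp only [Finset.mem_range] at hj ⊢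
  all_goals try simp only [blockReflect]
  any_goals split_ifs <;> omega
  congr 1
  split_ifs <;> omega

theorem blockAvg_eq_sum_blockReflect {a L : ℕ} (hL : L ≠ 0) (c : ℕ → ℝ≥0∞) (k : ℕ) :
    blockAvg a L c k = (L : ℝ≥0∞)⁻¹ * ∑ j ∈ Finset.range L, c (blockReflect a L j k) := by
  by_cases hk : a ≤ k ∧ k < a + L
  · rw [sum_blockReflect a L k c hk, blockAvg, if_pos hk, mul_comm, div_eq_mul_inv]
  · have : ∀ j, blockReflect a L j k = k := fun j => by
      unfold blockReflect; rw [if_neg]; omega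
    simp only [this, Finset.sum_const, Finset.card_range, nsmul_eq_mul, blockAvg, if_neg hk]
    rw [← mul_assoc, ENNReal.inv_mul_cancel (by exact_mod_cast hL) (ENNReal.natCast_ne_top L),
      one_mul]

/-- A discrete level function: `c` is averaged over finitely many blocks so that the result `d` is
antitone and its partial sums from the start of every block dominate those of `c`. -/
theorem exists_level_seq (Q : (ℕ → ℝ≥0∞) → ℝ≥0∞)
    (hQ : ∀ a L c, L ≠ 0 → Q (blockAvg a L c) ≤ Q c) (n : ℕ) :
    ∀ (a : ℕ) (c : ℕ → ℝ≥0∞), (∀ k, a + n ≤ k → c k = 0) →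
      ∃ d : ℕ → ℝ≥0∞, Q d ≤ Q c ∧ (∀ k < a, d k = c k) ∧ AntitoneOn d (Ici a) ∧
        (∀ A, (∀ m : ℕ, ∑ i ∈ Finset.range m, c (a + i) ≤ m * A) → d a ≤ A) ∧
        ∀ k, a ≤ k → ∃ u, a ≤ u ∧ u ≤ k ∧ (∀ i, u ≤ i → i ≤ k → d i = d k) ∧
          ∀ m, ∑ i ∈ Finset.range m, c (u + i) ≤ ∑ i ∈ Finset.range m, d (u + i) := by
  induction n using Nat.strong_induction_on with
  | _ n ih =>
  intro a c hc
  rcases Nat.eq_zero_or_pos n with rfl | hn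
  · refine ⟨c, le_rfl, fun _ _ => rfl, ?_, ?_, ?_⟩
    · intro i hi j hj _
      rw [hc i (by simpa using hi), hc j (by simpa using hj)]
    · intro A _
      simp [hc a (by simp)]
    · intro k hk
      refine ⟨k, hk, le_rfl, fun i h1 h2 => by rw [le_antisymm h2 h1], fun m => le_rfl⟩
  obtain ⟨L, hLmem, hLmax⟩ := Finset.exists_max_image (Finset.Icc 1 n)
    (fun L => (∑ i ∈ Finset.range L, c (a + i)) / (L : ℝ≥0∞)) ⟨1, by simp; omega⟩
  rw [Finset.mem_Icc] at hLmem
  set A : ℝ≥0∞ := (∑ i ∈ Finset.range L, c (a + i)) / (L : ℝ≥0∞) with hA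
  have hL0 : L ≠ 0 := by omega
  have hLA : ∑ i ∈ Finset.range L, c (a + i) = L * A := by
    rw [hA, ENNReal.mul_div_cancel (by exact_mod_cast hL0) (ENNReal.natCast_ne_top L)]
  have hsum : ∀ m : ℕ, ∑ i ∈ Finset.range m, c (a + i) ≤ m * A := by
    have small : ∀ m : ℕ, m ≤ n → ∑ i ∈ Finset.range m, c (a + i) ≤ m * A := by
      intro m hm
      rcases Nat.eq_zero_or_pos m with rfl | hm0
      · simp
      · have := hLmax m (by simp; omega)
        rwa [ENNReal.div_le_iff' (by exact_mod_cast hm0.ne') (ENNReal.natCast_ne_top m)] at this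
    intro m
    rcases le_total m n with hm | hm
    · exact small m hm
    · obtain ⟨e, rfl⟩ := Nat.exists_eq_add_of_le hm
      rw [Finset.sum_range_add, Finset.sum_eq_zero (s := Finset.range e)
        (fun i _ => hc _ (by omega)), add_zero]
      refine (small n le_rfl).trans ?_
      gcongr
  set c' := blockAvg a L c with hc'
  have hc'1 : ∀ k, a ≤ k → k < a + L → c' k = A := fun k h1 h2 => by
    rw [hc', blockAvg, if_pos ⟨h1, h2⟩]
  have hc'2 : ∀ k, a + L ≤ k → c' k = c k := fun k h1 => by
    rw [hc', blockAvg, if_neg (by omega)]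
  have hc'3 : ∀ k, k < a → c' k = c k := fun k h1 => by
    rw [hc', blockAvg, if_neg (by omega)]
  obtain ⟨d, hd1, hd2, hd3, hd4, hd5⟩ := ih (n - L) (by omega) (a + L) c' (fun k hk => by
    rw [hc'2 k (by omega)]; exact hc k (by omega))
  have hdA : ∀ k, a ≤ k → k < a + L → d k = A := fun k h1 h2 => by
    rw [hd2 k h2, hc'1 k h1 h2]
  have hdle : d (a + L) ≤ A := by
    refine hd4 A fun m => ?_
    rw [Finset.sum_congr rfl fun i _ => hc'2 (a + L + i) (by omega)]
    by_cases hAt : A = ∞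
    · rcases Nat.eq_zero_or_pos m with rfl | hm0
      · simp
      · rw [hAt, ENNReal.mul_top (by exact_mod_cast hm0.ne')]
        exact le_top
    · have h := hsum (L + m)
      rw [Finset.sum_range_add, hLA, Nat.cast_add, add_mul] at h
      have := (ENNReal.add_le_add_iff_left
        (ENNReal.mul_ne_top (ENNReal.natCast_ne_top L) hAt)).1 h
      simpa only [add_assoc] using this
  refine ⟨d, hd1.trans (hQ a L c hL0), fun k hk => by rw [hd2 k (by omega), hc'3 k hk],
    ?_, ?_, ?_⟩
  · intro i hi j hj hij
    simp only [mem_Ici] at hi hj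
    by_cases h1 : j < a + L
    · rw [hdA i hi (by omega), hdA j hj h1]
    · by_cases h2 : i < a + L
      · rw [hdA i hi h2]
        exact (hd3 (by simp) (by simpa using h1) (by omega)).trans hdle
      · exact hd3 (by simpa using h2) (by simpa using h1) hij
  · intro A' hA'
    rw [hdA a le_rfl (by omega), hA,
      ENNReal.div_le_iff' (by exact_mod_cast hL0) (ENNReal.natCast_ne_top L)]
    exact hA' L
  · intro k hk
    by_cases hkL : k < a + L
    · refine ⟨a, le_rfl, hk, fun i h1 h2 => by rw [hdA i h1 (by omega), hdA k hk hkL], ?_⟩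
      intro m
      rcases le_total m L with hm | hm
      · rw [Finset.sum_congr rfl fun i hi => hdA (a + i) (by omega)
          (by rw [Finset.mem_range] at hi; omega)]
        simpa using hsum m
      · obtain ⟨e, rfl⟩ := Nat.exists_eq_add_of_le hm
        rw [Finset.sum_range_add, Finset.sum_range_add]
        refine add_le_add ?_ ?_
        · rw [hLA, Finset.sum_congr rfl fun i hi => hdA (a + i) (by omega)
            (by rw [Finset.mem_range] at hi; omega)]
          simp
        · obtain ⟨u, hu1, hu2, -, hu4⟩ := hd5 (a + L) le_rfl
          obtain rfl : u = a + L := le_antisymm hu2 hu1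
          have := hu4 e
          rw [Finset.sum_congr rfl fun i _ => hc'2 (a + L + i) (by omega)] at this
          simpa only [add_assoc] using this
    · obtain ⟨u, hu1, hu2, hu3, hu4⟩ := hd5 k (by omega)
      refine ⟨u, by omega, hu2, hu3, fun m => ?_⟩
      rw [← Finset.sum_congr rfl fun i _ => hc'2 (u + i) (by omega)]
      exact hu4 m

/-- Summation by parts: domination of partial sums passes to antitone weights. -/
theorem sum_mul_le_sum_mul_of_antitone {c d : ℕ → ℝ≥0∞}
    (h : ∀ m, ∑ i ∈ Finset.range m, c i ≤ ∑ i ∈ Finset.range m, d i) (n : ℕ) :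
    ∀ W : ℕ → ℝ≥0∞, Antitone W →
      ∑ i ∈ Finset.range n, c i * W i ≤ ∑ i ∈ Finset.range n, d i * W i := by
  induction n with
  | zero => simp
  | succ n ih =>
    intro W hW
    have key : ∀ e : ℕ → ℝ≥0∞, ∑ i ∈ Finset.range (n + 1), e i * W i =
        (∑ i ∈ Finset.range (n + 1), e i) * W n + ∑ i ∈ Finset.range n, e i * (W i - W n) := by
      intro e
      rw [Finset.sum_range_succ, Finset.sum_range_succ, add_mul, add_right_comm, Finset.sum_mul,
        ← Finset.sum_add_distrib]
      congr 1
      refine Finset.sum_congr rfl fun i hi => ?_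
      rw [← mul_add, add_tsub_cancel_of_le (hW (Finset.mem_range.1 hi).le)]
    rw [key c, key d]
    gcongr ?_ * _ + ?_
    · exact h (n + 1)
    · exact ih (fun i => W i - W n) fun i j hij => tsub_le_tsub_right (hW hij) _

theorem Ici_eq_iUnion_Ico (a : ℝ) {δ : ℝ} (hδ : 0 < δ) :
    Ici a = ⋃ k : ℕ, Ico (a + k * δ) (a + (k + 1) * δ) := by
  ext x
  simp only [mem_Ici, mem_iUnion, mem_Ico]
  constructor
  · intro hx
    refine ⟨⌊(x - a) / δ⌋₊, ?_, ?_⟩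
    · have := (le_div_iff₀ hδ).1 (Nat.floor_le (div_nonneg (sub_nonneg.2 hx) hδ.le))
      linarith
    · have := (div_lt_iff₀ hδ).1 (Nat.lt_floor_add_one ((x - a) / δ))
      linarith
  · rintro ⟨k, hk, -⟩
    have : 0 ≤ (k : ℝ) * δ := by positivity
    linarith

theorem pairwise_disjoint_Ico_add_mul (a : ℝ) {δ : ℝ} (hδ : 0 < δ) :
    Pairwise (Function.onFun Disjoint fun k : ℕ => Ico (a + k * δ) (a + (k + 1) * δ)) := by
  have hm : Monotone fun k : ℕ => a + k * δ := fun i j hij => by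
    dsimp only; gcongr
  simpa using hm.pairwise_disjoint_on_Ico_succ

theorem setLIntegral_Ici_eq_tsum (F : ℝ → ℝ≥0∞) (a : ℝ) {δ : ℝ} (hδ : 0 < δ) :
    ∫⁻ x in Ici a, F x = ∑' k : ℕ, ∫⁻ x in Ico (a + k * δ) (a + (k + 1) * δ), F x := by
  rw [Ici_eq_iUnion_Ico a hδ, lintegral_iUnion (fun _ => measurableSet_Ico)
    (pairwise_disjoint_Ico_add_mul a hδ)]

theorem distrib_eq_tsum {f : ℝ → ℝ≥0∞} (hf : Measurable f) (s : ℝ≥0∞) {δ : ℝ} (hδ : 0 < δ) :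
    distrib f s = ∑' k : ℕ, volume ({t | s < f t} ∩ Ico (k * δ) ((k + 1) * δ)) := by
  have hm : MeasurableSet {t | s < f t} := measurableSet_lt measurable_const hf
  have h1 : distrib f s = volume.restrict (Ioi (0 : ℝ)) {t | s < f t} := by
    rw [Measure.restrict_apply hm, inter_comm]; rfl
  rw [h1, restrict_Ioi_eq_restrict_Ici, Ici_eq_iUnion_Ico 0 hδ,
    Measure.restrict_iUnion_apply (pairwise_disjoint_Ico_add_mul 0 hδ)
      (fun _ => measurableSet_Ico) hm]
  refine tsum_congr fun k => ?_
  rw [Measure.restrict_apply hm, zero_add, zero_add]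

/-- The step function with value `c k` on `[k ε, (k + 1) ε)`. -/
def stepFun (ε : ℝ) (c : ℕ → ℝ≥0∞) (x : ℝ) : ℝ≥0∞ := c ⌊x / ε⌋₊

theorem measurable_stepFun (ε : ℝ) (c : ℕ → ℝ≥0∞) : Measurable (stepFun ε c) :=
  (measurable_from_top (f := c)).comp (Nat.measurable_floor.comp (measurable_id.div_const ε))

theorem floor_div_eq {ε x : ℝ} (hε : 0 < ε) {k : ℕ} (hx : x ∈ Ico (k * ε) ((k + 1) * ε)) :
    ⌊x / ε⌋₊ = k := by
  have h0 : 0 ≤ x / ε := div_nonneg (le_trans (by positivity) hx.1) hε.le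
  rw [Nat.floor_eq_iff h0, le_div_iff₀ hε, div_lt_iff₀ hε]
  exact hx

theorem mem_Ico_floor_div {ε x : ℝ} (hε : 0 < ε) (hx : 0 ≤ x) :
    x ∈ Ico (⌊x / ε⌋₊ * ε) ((⌊x / ε⌋₊ + 1) * ε) := by
  have h0 : 0 ≤ x / ε := div_nonneg hx hε.le
  rw [mem_Ico, ← le_div_iff₀ hε, ← div_lt_iff₀ hε]
  exact ⟨Nat.floor_le h0, Nat.lt_floor_add_one _⟩

theorem stepFun_eq {ε x : ℝ} (hε : 0 < ε) (c : ℕ → ℝ≥0∞) {k : ℕ}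
    (hx : x ∈ Ico (k * ε) ((k + 1) * ε)) : stepFun ε c x = c k := by
  rw [stepFun, floor_div_eq hε hx]

theorem distrib_stepFun {ε : ℝ} (hε : 0 < ε) (c : ℕ → ℝ≥0∞) (s : ℝ≥0∞) :
    distrib (stepFun ε c) s = ∑' k : ℕ, if s < c k then ENNReal.ofReal ε else 0 := by
  rw [distrib_eq_tsum (measurable_stepFun ε c) s hε]
  refine tsum_congr fun k => ?_
  split_ifs with h
  · have : {t | s < stepFun ε c t} ∩ Ico (k * ε) ((k + 1) * ε) = Ico (k * ε) ((k + 1) * ε) :=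
      inter_eq_right.2 fun x hx => by rwa [mem_ofPred_eq, stepFun_eq hε c hx]
    rw [this, Real.volume_Ico]
    congr 1
    ring
  · have : {t | s < stepFun ε c t} ∩ Ico (k * ε) ((k + 1) * ε) = ∅ := by
      ext x
      simp only [mem_inter_iff, mem_ofPred_eq, mem_empty_iff_false, iff_false, not_and]
      intro h1 hx
      rw [stepFun_eq hε c hx] at h1
      exact h h1
    rw [this, measure_empty]

theorem RIBanachFunctionNorm.N_stepFun_comp_perm (X : RIBanachFunctionNorm) {ε : ℝ} (hε : 0 < ε)
    (c : ℕ → ℝ≥0∞) (σ : Equiv.Perm ℕ) : X.N (stepFun ε (c ∘ σ)) = X.N (stepFun ε c) := by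
  refine X.ri _ _ (measurable_stepFun _ _) (measurable_stepFun _ _) fun s => ?_
  rw [distrib_stepFun hε, distrib_stepFun hε]
  exact σ.tsum_eq fun k => if s < c k then ENNReal.ofReal ε else 0

theorem BanachFunctionNorm.N_sum_le (X : BanachFunctionNorm) {ι : Type*} (S : Finset ι)
    (f : ι → ℝ → ℝ≥0∞) (hf : ∀ i, Measurable (f i)) :
    X.N (fun t => ∑ i ∈ S, f i t) ≤ ∑ i ∈ S, X.N (f i) := by
  classical
  induction S using Finset.induction_on with
  | empty =>
    simp only [Finset.sum_empty, nonpos_iff_eq_zero]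
    exact (X.eq_zero_iff _ measurable_const).2 (by simp)
  | insert i S hi ih =>
    simp only [Finset.sum_insert hi]
    exact (X.add_le _ _ (hf i) (Finset.measurable_sum S fun j _ => hf j)).trans (by gcongr)

theorem RIBanachFunctionNorm.N_stepFun_blockAvg_le (X : RIBanachFunctionNorm) {ε : ℝ}
    (hε : 0 < ε) (a : ℕ) {L : ℕ} (hL : L ≠ 0) (c : ℕ → ℝ≥0∞) :
    X.N (stepFun ε (blockAvg a L c)) ≤ X.N (stepFun ε c) := by
  have hcast : (((L : ℝ≥0)⁻¹ : ℝ≥0) : ℝ≥0∞) = (L : ℝ≥0∞)⁻¹ := by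
    rw [ENNReal.coe_inv (by exact_mod_cast hL), ENNReal.coe_natCast]
  have h1 : stepFun ε (blockAvg a L c) = fun x => (((L : ℝ≥0)⁻¹ : ℝ≥0) : ℝ≥0∞) *
      ∑ j ∈ Finset.range L, stepFun ε (c ∘ (blockReflect_involutive a L j).toPerm) x := by
    funext x
    rw [hcast, stepFun, blockAvg_eq_sum_blockReflect hL]
    rfl
  rw [h1, X.smul _ _ (Finset.measurable_sum _ fun j _ => measurable_stepFun _ _), hcast]
  refine (mul_le_mul_right (X.N_sum_le _ _ fun j => measurable_stepFun _ _) _).trans ?_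
  simp only [X.N_stepFun_comp_perm hε, Finset.sum_const, Finset.card_range, nsmul_eq_mul]
  rw [← mul_assoc, ENNReal.inv_mul_cancel (by exact_mod_cast hL) (ENNReal.natCast_ne_top L),
    one_mul]

theorem distrib_comp_div_two (g : ℝ → ℝ≥0∞) (s : ℝ≥0∞) :
    distrib (fun t => g (t / 2)) s = 2 * distrib g s := by
  have h : {t : ℝ | t ∈ Ioi (0 : ℝ) ∧ s < g (t / 2)} =
      (fun x => x * (2⁻¹ : ℝ)) ⁻¹' {t : ℝ | t ∈ Ioi (0 : ℝ) ∧ s < g t} := by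
    ext t
    simp [div_eq_mul_inv]
  rw [distrib, h, Real.volume_preimage_mul_right (by norm_num)]
  simp [distrib]

/-- Dilation by the factor `2` has norm at most `2`: the dilated function is equimeasurable with
a sum of two disjointly supported copies of the original one. -/
theorem RIBanachFunctionNorm.N_comp_div_two_le (X : RIBanachFunctionNorm) {g : ℝ → ℝ≥0∞}
    (hg : Measurable g) : X.N (fun t => g (t / 2)) ≤ 2 * X.N g := by
  set G : ℝ → ℝ≥0∞ := fun t => g (t - ((⌊t / 1⌋₊ + 1) / 2 : ℕ)) with hG
  have hfl : Measurable fun t : ℝ => ⌊t / 1⌋₊ :=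
    Nat.measurable_floor.comp (measurable_id.div_const 1)
  have hGm : Measurable G := hg.comp <| measurable_id.sub <|
    (measurable_from_top (f := fun n : ℕ => (((n + 1) / 2 : ℕ) : ℝ))).comp hfl
  have key : ∀ (p : ℕ → Prop) [DecidablePred p] (s : ℝ≥0∞),
      distrib (fun t => if p ⌊t / 1⌋₊ then G t else 0) s =
        ∑' k : ℕ, if p k then
          volume ({t | s < g t} ∩ Ico (((k / 2 : ℕ) : ℝ) * 1) ((((k / 2 : ℕ) : ℝ) + 1) * 1))
          else 0 := by
    intro p _ s
    have hpm : Measurable fun t : ℝ => if p ⌊t / 1⌋₊ then G t else 0 :=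
      Measurable.ite (hfl (MeasurableSet.of_discrete (s := {n | p n}))) hGm measurable_const
    rw [distrib_eq_tsum hpm s one_pos]
    refine tsum_congr fun k => ?_
    split_ifs with hk
    · rw [← measure_preimage_add_right volume (-(((k + 1) / 2 : ℕ) : ℝ)) ({t | s < g t} ∩ _)]
      simp only [← sub_eq_add_neg]
      congr 1
      have hkk : (k : ℝ) = ((k / 2 : ℕ) : ℝ) + (((k + 1) / 2 : ℕ) : ℝ) := by
        rw [← Nat.cast_add]; congr 1; omega
      ext t
      simp only [mem_inter_iff, mem_ofPred_eq, mem_preimage]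
      constructor
      · rintro ⟨h1, h2⟩
        rw [floor_div_eq one_pos h2, if_pos hk, hG] at h1
        simp only [floor_div_eq one_pos h2] at h1
        refine ⟨h1, ?_⟩
        rw [mem_Ico] at h2 ⊢
        constructor <;> linarith [h2.1, h2.2]
      · rintro ⟨h1, h2⟩
        have h3 : t ∈ Ico ((k : ℝ) * 1) (((k : ℝ) + 1) * 1) := by
          rw [mem_Ico] at h2 ⊢
          constructor <;> linarith [h2.1, h2.2]
        refine ⟨?_, h3⟩
        rw [floor_div_eq one_pos h3, if_pos hk, hG]
        simpa only [floor_div_eq one_pos h3] using h1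
    · refine measure_mono_null (t := ∅) ?_ measure_empty
      rintro t ⟨h1, h2⟩
      rw [mem_ofPred_eq, floor_div_eq one_pos h2, if_neg hk] at h1
      exact absurd h1 not_lt_zero
  have hmeas : ∀ (p : ℕ → Prop) [DecidablePred p],
      Measurable fun t : ℝ => if p ⌊t / 1⌋₊ then G t else 0 := fun p _ =>
    Measurable.ite (hfl (MeasurableSet.of_discrete (s := {n | p n}))) hGm measurable_const
  have hhalf : ∀ (p : ℕ → Prop) [DecidablePred p], ((∀ n, p (2 * n)) ∧ (∀ n, ¬ p (2 * n + 1)) ∨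
      (∀ n, ¬ p (2 * n)) ∧ (∀ n, p (2 * n + 1))) →
      X.N (fun t => if p ⌊t / 1⌋₊ then G t else 0) = X.N g := by
    intro p _ hp
    refine X.ri _ _ (hmeas p) hg fun s => ?_
    rw [key p s, distrib_eq_tsum hg s one_pos,
      ← tsum_even_add_odd ENNReal.summable ENNReal.summable]
    have e1 : ∀ n : ℕ, (2 * n + 1) / 2 = n := fun n => by omega
    have e2 : ∀ n : ℕ, (2 * n) / 2 = n := fun n => by omega
    rcases hp with ⟨h1, h2⟩ | ⟨h1, h2⟩ <;> simp [h1, h2, e1, e2]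
  have hsum : X.N (fun t => g (t / 2)) = X.N G := by
    refine X.ri _ _ (hg.comp (measurable_id.div_const 2)) hGm fun s => ?_
    have h1 : distrib G s = ∑' k : ℕ,
        volume ({t | s < g t} ∩ Ico (((k / 2 : ℕ) : ℝ) * 1) ((((k / 2 : ℕ) : ℝ) + 1) * 1)) := by
      exact key (fun _ => True) s
    rw [distrib_comp_div_two, h1, ← tsum_even_add_odd ENNReal.summable ENNReal.summable,
      distrib_eq_tsum hg s one_pos, two_mul]
    have e1 : ∀ n : ℕ, (2 * n + 1) / 2 = n := fun n => by omega
    have e2 : ∀ n : ℕ, (2 * n) / 2 = n := fun n => by omega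
    simp only [e1, e2]
  have hdec : G = fun t => (if Even ⌊t / 1⌋₊ then G t else 0) +
      (if ¬ Even ⌊t / 1⌋₊ then G t else 0) := by
    funext t
    by_cases h : Even ⌊t / 1⌋₊ <;> simp only [h, if_true, if_false, not_true, not_false_iff,
      add_zero, zero_add]
  calc X.N (fun t => g (t / 2)) = X.N G := hsum
    _ ≤ X.N (fun t => if Even ⌊t / 1⌋₊ then G t else 0) +
        X.N (fun t => if ¬ Even ⌊t / 1⌋₊ then G t else 0) := by
      conv_lhs => rw [hdec]
      exact X.add_le _ _ (hmeas Even) (hmeas fun n => ¬ Even n)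
    _ = 2 * X.N g := by
      rw [hhalf Even (Or.inl (by simp)), hhalf (fun n => ¬ Even n) (Or.inr (by simp)), two_mul]

/-- The weighted tail integral `t ↦ ∫_t^∞ f w`. -/
def weightedTail (w f : ℝ → ℝ≥0∞) (t : ℝ) : ℝ≥0∞ := ∫⁻ s in Ioi t, f s * w s

theorem antitone_weightedTail (w f : ℝ → ℝ≥0∞) : Antitone (weightedTail w f) :=
  fun _ _ h => lintegral_mono_set (Ioi_subset_Ioi h)

theorem measurable_weightedTail (w f : ℝ → ℝ≥0∞) : Measurable (weightedTail w f) :=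
  (antitone_weightedTail w f).measurable

theorem antitone_stepFun {ε : ℝ} (hε : 0 < ε) {d : ℕ → ℝ≥0∞} (hd : Antitone d) :
    Antitone (stepFun ε d) :=
  fun _ _ h => hd (Nat.floor_le_floor (by gcongr))

theorem setLIntegral_Ici_stepFun_mul {ε : ℝ} (hε : 0 < ε) (c : ℕ → ℝ≥0∞) {v : ℝ → ℝ≥0∞}
    (hv : Measurable v) (u : ℕ) :
    ∫⁻ x in Ici (u * ε), stepFun ε c x * v x =
      ∑' i : ℕ, c (u + i) * ∫⁻ x in Ico (u * ε + i * ε) (u * ε + (i + 1) * ε), v x := by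
  rw [setLIntegral_Ici_eq_tsum _ _ hε]
  refine tsum_congr fun i => ?_
  rw [← lintegral_const_mul _ hv]
  refine setLIntegral_congr_fun measurableSet_Ico fun x hx => ?_
  rw [stepFun_eq hε c (k := u + i)]
  rw [mem_Ico] at hx ⊢
  push_cast
  constructor <;> linarith [hx.1, hx.2]

theorem antitone_setLIntegral_Ico (ε : ℝ) {v : ℝ → ℝ≥0∞} (hv : Antitone v) (a : ℝ) :
    Antitone fun i : ℕ => ∫⁻ x in Ico (a + i * ε) (a + (i + 1) * ε), v x := by
  refine antitone_nat_of_succ_le fun i => ?_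
  have hvol : ∀ b : ℝ, volume (Ico (a + b * ε) (a + (b + 1) * ε)) = ENNReal.ofReal ε := fun b => by
    rw [Real.volume_Ico]; congr 1; ring
  calc ∫⁻ x in Ico (a + ((i + 1 : ℕ) : ℝ) * ε) (a + (((i + 1 : ℕ) : ℝ) + 1) * ε), v x
      ≤ ∫⁻ _ in Ico (a + ((i + 1 : ℕ) : ℝ) * ε) (a + (((i + 1 : ℕ) : ℝ) + 1) * ε),
          v (a + (i + 1) * ε) :=
        setLIntegral_mono' measurableSet_Ico fun x hx => hv (by
          have := hx.1
          push_cast at this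
          exact this)
    _ = ∫⁻ _ in Ico (a + i * ε) (a + (i + 1) * ε), v (a + (i + 1) * ε) := by
        rw [setLIntegral_const, setLIntegral_const, hvol, hvol]
    _ ≤ ∫⁻ x in Ico (a + i * ε) (a + (i + 1) * ε), v x :=
        setLIntegral_mono' measurableSet_Ico fun x hx => hv hx.2.le

theorem weightedTail_stepFun_le {w : ℝ → ℝ≥0∞} (hw : Antitone w) {ε : ℝ} (hε : 0 < ε)
    {c d : ℕ → ℝ≥0∞} {n : ℕ} (hc : ∀ k, n ≤ k → c k = 0) (hd : Antitone d)
    (hlev : ∀ k, ∃ u ≤ k, (∀ i, u ≤ i → i ≤ k → d i = d k) ∧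
      ∀ m, ∑ i ∈ Finset.range m, c (u + i) ≤ ∑ i ∈ Finset.range m, d (u + i))
    {t : ℝ} (ht : 0 < t) :
    weightedTail w (stepFun ε c) t ≤ 2 * weightedTail w (stepFun ε d) (t / 2) := by
  set k := ⌊t / ε⌋₊ with hk
  have htk := mem_Ico_floor_div hε ht.le
  rw [← hk] at htk
  obtain ⟨u, huk, hconst, hdom⟩ := hlev k
  have hut : (u : ℝ) * ε ≤ t := le_trans (by gcongr) htk.1
  set v : ℝ → ℝ≥0∞ := fun s => w (max s t) with hv
  have hva : Antitone v := fun x y h => hw (max_le_max_right t h)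
  have htail : ∀ e : ℕ → ℝ≥0∞, weightedTail w (stepFun ε e) t =
      ∫⁻ s in Ioi t, stepFun ε e s * v s := fun e =>
    setLIntegral_congr_fun measurableSet_Ioi fun x hx => by
      simp only [hv, max_eq_left (mem_Ioi.1 hx).le]
  have hdk : stepFun ε d t = d k := stepFun_eq hε d htk
  have h1 : ∫⁻ s in Ici (u * ε), stepFun ε c s * v s ≤
      ∫⁻ s in Ici (u * ε), stepFun ε d s * v s := by
    rw [setLIntegral_Ici_stepFun_mul hε c hva.measurable,
      setLIntegral_Ici_stepFun_mul hε d hva.measurable,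
      tsum_eq_sum (s := Finset.range n) fun i hi => by
        rw [hc _ (by rw [Finset.mem_range] at hi; omega), zero_mul]]
    exact (sum_mul_le_sum_mul_of_antitone hdom n _ (antitone_setLIntegral_Ico ε hva _)).trans
      (ENNReal.sum_le_tsum _)
  have h2 : ∫⁻ s in Ici (u * ε), stepFun ε d s * v s ≤
      d k * w t * ENNReal.ofReal t + weightedTail w (stepFun ε d) t := by
    rw [← Ico_union_Ici_eq_Ici hut, htail]
    refine (lintegral_union_le _ _ _).trans ?_
    rw [restrict_Ioi_eq_restrict_Ici]
    refine add_le_add ?_ le_rfl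
    calc ∫⁻ s in Ico (u * ε) t, stepFun ε d s * v s
        = ∫⁻ _ in Ico (u * ε) t, d k * w t := by
          refine setLIntegral_congr_fun measurableSet_Ico fun x hx => ?_
          have hx0 : 0 ≤ x := le_trans (by positivity) hx.1
          simp only [hv, max_eq_right hx.2.le]
          rw [stepFun, hconst]
          · exact Nat.le_floor ((le_div_iff₀ hε).2 hx.1)
          · exact Nat.floor_le_floor (by gcongr; exact hx.2.le)
      _ ≤ d k * w t * ENNReal.ofReal t := by
          rw [setLIntegral_const, Real.volume_Ico]
          gcongr
          have : 0 ≤ (u : ℝ) * ε := by positivity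
          linarith
  have h3 : d k * w t * ENNReal.ofReal (t / 2) + weightedTail w (stepFun ε d) t ≤
      weightedTail w (stepFun ε d) (t / 2) := by
    rw [weightedTail, weightedTail, ← Ioc_union_Ioi_eq_Ioi (by linarith : t / 2 ≤ t),
      lintegral_union measurableSet_Ioi
        (Set.disjoint_left.2 fun x hx hx' => absurd hx.2 (not_le.2 hx'))]
    gcongr
    calc d k * w t * ENNReal.ofReal (t / 2) = ∫⁻ _ in Ioc (t / 2) t, d k * w t := by
          rw [setLIntegral_const, Real.volume_Ioc]; congr 2; ring
      _ ≤ _ := setLIntegral_mono' measurableSet_Ioc fun x hx => by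
          rw [← hdk]
          exact mul_le_mul' (antitone_stepFun hε hd hx.2) (hw hx.2)
  calc weightedTail w (stepFun ε c) t
      ≤ ∫⁻ s in Ici (u * ε), stepFun ε c s * v s := by
        rw [htail]
        exact lintegral_mono_set fun x hx => hut.trans (mem_Ioi.1 hx).le
    _ ≤ d k * w t * ENNReal.ofReal t + weightedTail w (stepFun ε d) t := h1.trans h2
    _ ≤ 2 * (d k * w t * ENNReal.ofReal (t / 2) + weightedTail w (stepFun ε d) t) := by
        rw [mul_add]
        refine add_le_add (le_of_eq ?_) (le_mul_of_one_le_left' one_le_two)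
        have : ENNReal.ofReal t = 2 * ENNReal.ofReal (t / 2) := by
          rw [← ENNReal.ofReal_ofNat 2, ← ENNReal.ofReal_mul (by norm_num)]
          congr 1; ring
        rw [this]; ring
    _ ≤ _ := by gcongr

theorem N_weightedTail_stepFun_le (X Y : RIBanachFunctionNorm) {w : ℝ → ℝ≥0∞} (hw : Antitone w)
    {C : ℝ≥0∞} (hC : ∀ f : ℝ → ℝ≥0∞, Measurable f → AntitoneOn f (Ioi 0) → X.N f < ∞ →
      Y.N (weightedTail w f) ≤ C * X.N f)
    {ε : ℝ} (hε : 0 < ε) {c : ℕ → ℝ≥0∞} {n : ℕ} (hc : ∀ k, n ≤ k → c k = 0)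
    (hfin : X.N (stepFun ε c) < ∞) :
    Y.N (weightedTail w (stepFun ε c)) ≤ 4 * C * X.N (stepFun ε c) := by
  obtain ⟨d, hd1, -, hd3, -, hd5⟩ := exists_level_seq (fun c => X.N (stepFun ε c))
    (fun a L c hL => X.N_stepFun_blockAvg_le hε a hL c) n 0 c (by simpa using hc)
  have hda : Antitone d := fun i j h => hd3 (by simp) (by simp) h
  have hle : ∀ᵐ t ∂(volume.restrict (Ioi (0 : ℝ))), weightedTail w (stepFun ε c) t ≤
      2 * weightedTail w (stepFun ε d) (t / 2) := by
    refine (ae_restrict_iff' measurableSet_Ioi).2 (Eventually.of_forall fun t ht => ?_)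
    exact weightedTail_stepFun_le hw hε hc hda
      (fun k => (hd5 k (Nat.zero_le k)).imp fun u hu => ⟨hu.2.1, hu.2.2⟩) ht
  have hm := measurable_weightedTail w (stepFun ε d)
  have hm2 : Measurable fun t => weightedTail w (stepFun ε d) (t / 2) :=
    hm.comp (measurable_id.div_const 2)
  calc Y.N (weightedTail w (stepFun ε c))
      ≤ Y.N (fun t => 2 * weightedTail w (stepFun ε d) (t / 2)) :=
        Y.mono _ _ (measurable_weightedTail _ _) (hm2.const_mul 2) hle
    _ = 2 * Y.N (fun t => weightedTail w (stepFun ε d) (t / 2)) := Y.smul 2 _ hm2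
    _ ≤ 2 * (2 * (C * X.N (stepFun ε d))) := by
        gcongr
        refine (Y.N_comp_div_two_le hm).trans ?_
        gcongr
        exact hC _ (measurable_stepFun _ _) ((antitone_stepFun hε hda).antitoneOn _)
          (hd1.trans_lt hfin)
    _ ≤ 2 * (2 * (C * X.N (stepFun ε c))) := by gcongr
    _ = 4 * C * X.N (stepFun ε c) := by ring

theorem BanachFunctionNorm.N_congr_ae (X : BanachFunctionNorm) {f g : ℝ → ℝ≥0∞}
    (hf : Measurable f) (hg : Measurable g)
    (h : ∀ᵐ t ∂(volume.restrict (Ioi (0 : ℝ))), f t = g t) : X.N f = X.N g :=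
  le_antisymm (X.mono f g hf hg (h.mono fun _ h => h.le))
    (X.mono g f hg hf (h.mono fun _ h => h.ge))

/-- The value on the `i`-th cell of the `j`-th dyadic lower step approximation of `g`. -/
def dyadicInf (g : ℝ → ℝ≥0∞) (j i : ℕ) : ℝ≥0∞ :=
  if i < 4 ^ j then ⨅ (y : ℝ) (_ : ⌊y / ((2 : ℝ) ^ j)⁻¹⌋₊ = i), g y else 0

theorem stepFun_dyadicInf_le (g : ℝ → ℝ≥0∞) (j : ℕ) (x : ℝ) :
    stepFun ((2 : ℝ) ^ j)⁻¹ (dyadicInf g j) x ≤ g x := by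
  unfold stepFun dyadicInf
  split_ifs
  · exact (iInf_le _ x).trans (iInf_le _ rfl)
  · exact zero_le

theorem monotone_stepFun_dyadicInf (g : ℝ → ℝ≥0∞) (x : ℝ) :
    Monotone fun j : ℕ => stepFun ((2 : ℝ) ^ j)⁻¹ (dyadicInf g j) x := by
  refine monotone_nat_of_le_succ fun j => ?_
  have hfl : ∀ y : ℝ, ⌊y / ((2 : ℝ) ^ j)⁻¹⌋₊ = ⌊y / ((2 : ℝ) ^ (j + 1))⁻¹⌋₊ / 2 := fun y => by
    rw [← Nat.floor_div_natCast]
    congr 1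
    push_cast
    field_simp
    ring
  unfold stepFun dyadicInf
  split_ifs with h1 h2
  · exact le_iInf₂ fun y hy => iInf₂_le y (by rw [hfl y, hfl x, hy])
  · rw [hfl x] at h1
    have : 4 ^ (j + 1) = 4 * 4 ^ j := pow_succ' 4 j
    omega
  · exact zero_le
  · exact le_rfl

theorem iSup_stepFun_dyadicInf {g : ℝ → ℝ≥0∞} {x : ℝ} (hx : 0 < x)
    (hg : ∀ s < g x, ∀ᶠ y in 𝓝 x, s < g y) :
    ⨆ j : ℕ, stepFun ((2 : ℝ) ^ j)⁻¹ (dyadicInf g j) x = g x := by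
  refine le_antisymm (iSup_le fun j => stepFun_dyadicInf_le g j x) ?_
  refine le_of_forall_lt_imp_le_of_dense fun s hs => ?_
  obtain ⟨r, hr, hball⟩ := Metric.eventually_nhds_iff.1 (hg s hs)
  have h2 : Tendsto (fun j : ℕ => (2 : ℝ) ^ j) atTop atTop :=
    tendsto_pow_atTop_atTop_of_one_lt one_lt_two
  obtain ⟨j, hj1, hj2, hj3⟩ := ((h2.eventually_gt_atTop r⁻¹).and
    ((h2.eventually_gt_atTop x).and (h2.eventually_gt_atTop x⁻¹))).exists
  refine le_trans ?_ (le_iSup _ j)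
  have h2j : (0 : ℝ) < 2 ^ j := by positivity
  have hx1 : 1 < x * 2 ^ j := by
    rwa [inv_lt_iff_one_lt_mul₀' hx] at hj3
  have hr1 : 1 < r * 2 ^ j := by
    rwa [inv_lt_iff_one_lt_mul₀' hr] at hj1
  unfold stepFun dyadicInf
  simp only [div_inv_eq_mul]
  rw [if_pos]
  · refine le_iInf₂ fun y hy => (hball ?_).le
    have hfx : 1 ≤ ⌊x * 2 ^ j⌋₊ := Nat.one_le_floor_iff _ |>.2 hx1.le
    have hy0 : 0 ≤ y * 2 ^ j := (Nat.pos_of_floor_pos (by omega)).le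
    have hx1 := Nat.floor_le (mul_pos hx h2j).le
    have hx2 := Nat.lt_floor_add_one (x * 2 ^ j)
    have hy1 := Nat.floor_le hy0
    have hy2 := Nat.lt_floor_add_one (y * 2 ^ j)
    rw [hy] at hy1 hy2
    rw [Real.dist_eq, abs_lt]
    constructor <;> nlinarith
  · rw [Nat.floor_lt (mul_pos hx h2j).le]
    push_cast
    have : (4 : ℝ) ^ j = 2 ^ j * 2 ^ j := by rw [← mul_pow]; norm_num
    rw [this]
    gcongr

theorem N_weightedTail_le_of_lowerSemicontinuous (X Y : RIBanachFunctionNorm) {w : ℝ → ℝ≥0∞}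
    (hw : Measurable w) {K : ℝ≥0∞}
    (hK : ∀ (ε : ℝ), 0 < ε → ∀ (c : ℕ → ℝ≥0∞) (n : ℕ), (∀ k, n ≤ k → c k = 0) →
      X.N (stepFun ε c) < ∞ → Y.N (weightedTail w (stepFun ε c)) ≤ K * X.N (stepFun ε c))
    {g : ℝ → ℝ≥0∞} (hg : Measurable g)
    (hlsc : ∀ᵐ x ∂(volume.restrict (Ioi (0 : ℝ))), ∀ s < g x, ∀ᶠ y in 𝓝 x, s < g y)
    (hfin : X.N g < ∞) : Y.N (weightedTail w g) ≤ K * X.N g := by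
  set G : ℕ → ℝ → ℝ≥0∞ := fun j => stepFun ((2 : ℝ) ^ j)⁻¹ (dyadicInf g j) with hG
  have hGm : ∀ j, Measurable (G j) := fun j => measurable_stepFun _ _
  have hGX : ∀ j, X.N (G j) ≤ X.N g := fun j =>
    X.mono _ _ (hGm j) hg (Eventually.of_forall fun x => stepFun_dyadicInf_le g j x)
  have hsup : ∀ᵐ x ∂(volume.restrict (Ioi (0 : ℝ))), ⨆ j, G j x = g x := by
    filter_upwards [hlsc, ae_restrict_mem measurableSet_Ioi] with x hx hx0
    exact iSup_stepFun_dyadicInf hx0 hx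
  rw [Y.fatou (fun j => weightedTail w (G j)) (weightedTail w g)
    (fun j => measurable_weightedTail _ _) (measurable_weightedTail _ _)]
  · refine iSup_le fun j => (hK _ (by positivity) _ (4 ^ j) (fun k hk => ?_)
      ((hGX j).trans_lt hfin)).trans (by gcongr; exact hGX j)
    rw [dyadicInf, if_neg (not_lt.2 hk)]
  · refine Eventually.of_forall fun t i j hij => lintegral_mono fun x => ?_
    exact mul_le_mul_left (monotone_stepFun_dyadicInf g x hij) _
  · filter_upwards [ae_restrict_mem measurableSet_Ioi] with t ht
    unfold weightedTail
    have hlim := lintegral_iSup' (μ := volume.restrict (Ioi t)) (f := fun j x => G j x * w x)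
      (fun j => ((hGm j).mul hw).aemeasurable) (Eventually.of_forall
      fun x i j hij => mul_le_mul_left (monotone_stepFun_dyadicInf g x hij) _)
    rw [← hlim]
    refine lintegral_congr_ae ?_
    filter_upwards [ae_mono (Measure.restrict_mono (Ioi_subset_Ioi (le_of_lt ht)) le_rfl) hsup]
      with x hx
    rw [← ENNReal.iSup_mul, hx]

/-- The distribution function of `f` on the `k`-th cell of length `δ`. -/
def cellDistrib (δ : ℝ) (f : ℝ → ℝ≥0∞) (k : ℕ) (s : ℝ≥0∞) : ℝ≥0∞ :=
  volume ({t | s < f t} ∩ Ico (k * δ) ((k + 1) * δ))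

/-- The function obtained by rearranging `f` decreasingly on each cell of length `δ`. -/
def cellRearr (δ : ℝ) (f : ℝ → ℝ≥0∞) (x : ℝ) : ℝ≥0∞ :=
  sInf {s | cellDistrib δ f ⌊x / δ⌋₊ s ≤ ENNReal.ofReal (x - ⌊x / δ⌋₊ * δ)}

theorem cellDistrib_le (δ : ℝ) (f : ℝ → ℝ≥0∞) (k : ℕ) (s : ℝ≥0∞) :
    cellDistrib δ f k s ≤ ENNReal.ofReal δ := by
  refine (measure_mono inter_subset_right).trans ?_
  rw [Real.volume_Ico]
  exact ENNReal.ofReal_le_ofReal (by linarith)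

theorem antitone_cellDistrib (δ : ℝ) (f : ℝ → ℝ≥0∞) (k : ℕ) : Antitone (cellDistrib δ f k) :=
  fun _ _ h => measure_mono (inter_subset_inter_left _ fun _ hx => lt_of_le_of_lt h hx)

theorem exists_lt_cellDistrib {δ : ℝ} {f : ℝ → ℝ≥0∞} {k : ℕ} {s a : ℝ≥0∞}
    (h : a < cellDistrib δ f k s) : ∃ s' > s, a < cellDistrib δ f k s' := by
  have hs : s < ∞ := by
    rw [lt_top_iff_ne_top]
    rintro rfl
    simp [cellDistrib] at h
  obtain ⟨u, hu, hmem, hlim⟩ := exists_seq_strictAnti_tendsto' hs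
  have hU : {t | s < f t} ∩ Ico (k * δ) ((k + 1) * δ) =
      ⋃ n, {t | u n < f t} ∩ Ico (k * δ) ((k + 1) * δ) := by
    rw [← iUnion_inter]
    congr 1
    ext t
    simp only [mem_ofPred_eq, mem_iUnion]
    constructor
    · intro ht
      exact (hlim.eventually (gt_mem_nhds ht)).exists
    · rintro ⟨n, hn⟩
      exact (hmem n).1.trans hn
  have hmono : Monotone fun n => {t | u n < f t} ∩ Ico (k * δ) ((k + 1) * δ) :=
    fun i j hij => inter_subset_inter_left _ fun x hx => lt_of_le_of_lt (hu.antitone hij) hx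
  rw [cellDistrib, hU, hmono.measure_iUnion, lt_iSup_iff] at h
  obtain ⟨n, hn⟩ := h
  exact ⟨u n, (hmem n).1, hn⟩

theorem lt_cellRearr_iff {δ : ℝ} (hδ : 0 < δ) {f : ℝ → ℝ≥0∞} {k : ℕ} {x : ℝ}
    (hx : x ∈ Ico (k * δ) ((k + 1) * δ)) {s : ℝ≥0∞} :
    s < cellRearr δ f x ↔ ENNReal.ofReal (x - k * δ) < cellDistrib δ f k s := by
  rw [cellRearr, floor_div_eq hδ hx]
  constructor
  · intro h
    by_contra! h'
    exact absurd (show sInf {s | cellDistrib δ f k s ≤ ENNReal.ofReal (x - k * δ)} ≤ s from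
      sInf_le h') (not_le.2 h)
  · intro h
    obtain ⟨s', hs', h'⟩ := exists_lt_cellDistrib h
    refine hs'.trans_le (le_sInf fun r hr => ?_)
    by_contra! hlt
    exact absurd ((antitone_cellDistrib δ f k hlt.le).trans hr) (not_le.2 h')

theorem setOf_lt_cellRearr_inter {δ : ℝ} (hδ : 0 < δ) (f : ℝ → ℝ≥0∞) (k : ℕ) (s : ℝ≥0∞) :
    {x | s < cellRearr δ f x} ∩ Ico (k * δ) ((k + 1) * δ) =
      Ico (k * δ) (k * δ + (cellDistrib δ f k s).toReal) := by
  have hle := cellDistrib_le δ f k s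
  have hne : cellDistrib δ f k s ≠ ∞ := (hle.trans_lt ENNReal.ofReal_lt_top).ne
  have hle' : (cellDistrib δ f k s).toReal ≤ δ := ENNReal.toReal_le_of_le_ofReal hδ.le hle
  ext x
  constructor
  · rintro ⟨h1, h2⟩
    rw [mem_ofPred_eq, lt_cellRearr_iff hδ h2,
      ENNReal.ofReal_lt_iff_lt_toReal (sub_nonneg.2 h2.1) hne] at h1
    exact ⟨h2.1, by linarith⟩
  · rintro ⟨h1, h2⟩
    have h3 : x ∈ Ico (k * δ) ((k + 1) * δ) := ⟨h1, by linarith⟩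
    refine ⟨?_, h3⟩
    rw [mem_ofPred_eq, lt_cellRearr_iff hδ h3,
      ENNReal.ofReal_lt_iff_lt_toReal (sub_nonneg.2 h1) hne]
    linarith

theorem measurable_cellRearr (δ : ℝ) (f : ℝ → ℝ≥0∞) : Measurable (cellRearr δ f) := by
  have hanti : ∀ k : ℕ, Antitone fun y : ℝ =>
      sInf {s : ℝ≥0∞ | cellDistrib δ f k s ≤ ENNReal.ofReal y} := fun k y z hyz =>
    sInf_le_sInf fun s (hs : cellDistrib δ f k s ≤ ENNReal.ofReal y) =>
      hs.trans (ENNReal.ofReal_le_ofReal hyz)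
  have hFm : Measurable fun p : ℕ × ℝ =>
      sInf {s : ℝ≥0∞ | cellDistrib δ f p.1 s ≤ ENNReal.ofReal p.2} :=
    measurable_from_prod_countable_right fun k => (hanti k).measurable
  have hfl : Measurable fun x : ℝ => ⌊x / δ⌋₊ :=
    Nat.measurable_floor.comp (measurable_id.div_const δ)
  have hcast : Measurable fun x : ℝ => x - ⌊x / δ⌋₊ * δ :=
    measurable_id.sub (((measurable_of_countable fun n : ℕ => (n : ℝ)).comp hfl).mul_const δ)
  have heq : cellRearr δ f = (fun p : ℕ × ℝ =>
      sInf {s : ℝ≥0∞ | cellDistrib δ f p.1 s ≤ ENNReal.ofReal p.2}) ∘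
      fun x => (⌊x / δ⌋₊, x - ⌊x / δ⌋₊ * δ) := rfl
  rw [heq]
  exact Measurable.comp hFm (Measurable.prodMk hfl hcast)

theorem distrib_cellRearr {δ : ℝ} (hδ : 0 < δ) {f : ℝ → ℝ≥0∞} (hf : Measurable f) (s : ℝ≥0∞) :
    distrib (cellRearr δ f) s = distrib f s := by
  rw [distrib_eq_tsum (measurable_cellRearr δ f) s hδ, distrib_eq_tsum hf s hδ]
  refine tsum_congr fun k => ?_
  rw [setOf_lt_cellRearr_inter hδ, Real.volume_Ico, add_sub_cancel_left, ENNReal.ofReal_toReal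
    ((cellDistrib_le δ f k s).trans_lt ENNReal.ofReal_lt_top).ne]
  rfl

theorem ae_lowerSemicontinuousAt_cellRearr {δ : ℝ} (hδ : 0 < δ) (f : ℝ → ℝ≥0∞) :
    ∀ᵐ x ∂(volume.restrict (Ioi (0 : ℝ))), ∀ s < cellRearr δ f x,
      ∀ᶠ y in 𝓝 x, s < cellRearr δ f y := by
  have hc : ∀ᵐ x ∂(volume.restrict (Ioi (0 : ℝ))), x ∉ range fun k : ℕ => (k : ℝ) * δ :=
    ae_restrict_of_ae ((countable_range _).ae_notMem volume)
  filter_upwards [hc, ae_restrict_mem measurableSet_Ioi] with x hx hx0 s hs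
  have hxk := mem_Ico_floor_div hδ (le_of_lt hx0)
  set k := ⌊x / δ⌋₊
  have hlt : (k : ℝ) * δ < x := lt_of_le_of_ne hxk.1 fun h => hx ⟨k, h⟩
  rw [lt_cellRearr_iff hδ hxk] at hs
  have hcont : Continuous fun y : ℝ => ENNReal.ofReal (y - k * δ) :=
    ENNReal.continuous_ofReal.comp (continuous_id.sub continuous_const)
  filter_upwards [hcont.continuousAt.eventually (gt_mem_nhds hs), Ioo_mem_nhds hlt hxk.2]
    with y hy1 hy2
  exact (lt_cellRearr_iff hδ (Ioo_subset_Ico_self hy2)).2 hy1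

theorem lintegral_eq_lintegral_measure_lt (μ : Measure ℝ) [SFinite μ] {f : ℝ → ℝ≥0∞}
    (hf : Measurable f) :
    ∫⁻ x, f x ∂μ = ∫⁻ s in Ioi (0 : ℝ), μ {x | ENNReal.ofReal s < f x} := by
  have hpt : ∀ a : ℝ≥0∞, a = ∫⁻ s in Ioi (0 : ℝ), {s : ℝ | ENNReal.ofReal s < a}.indicator 1 s := by
    intro a
    have hm : MeasurableSet {s : ℝ | ENNReal.ofReal s < a} :=
      measurableSet_lt ENNReal.measurable_ofReal measurable_const
    rw [lintegral_indicator_one hm, Measure.restrict_apply hm]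
    by_cases ha : a = ∞
    · simp [ha]
    · have : {s : ℝ | ENNReal.ofReal s < a} ∩ Ioi 0 = Ioo 0 a.toReal := by
        ext s
        simp only [mem_inter_iff, mem_ofPred_eq, mem_Ioi, mem_Ioo]
        constructor
        · rintro ⟨h1, h2⟩
          exact ⟨h2, (ENNReal.ofReal_lt_iff_lt_toReal h2.le ha).1 h1⟩
        · rintro ⟨h1, h2⟩
          exact ⟨(ENNReal.ofReal_lt_iff_lt_toReal h1.le ha).2 h2, h1⟩
      rw [this, Real.volume_Ioo, sub_zero, ENNReal.ofReal_toReal ha]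
  have hms : MeasurableSet {p : ℝ × ℝ | ENNReal.ofReal p.2 < f p.1} :=
    measurableSet_lt (ENNReal.measurable_ofReal.comp measurable_snd) (hf.comp measurable_fst)
  have hind : Measurable ({p : ℝ × ℝ | ENNReal.ofReal p.2 < f p.1}.indicator
      (1 : ℝ × ℝ → ℝ≥0∞)) := measurable_one.indicator hms
  calc ∫⁻ x, f x ∂μ
      = ∫⁻ x, (∫⁻ s in Ioi (0 : ℝ), {s : ℝ | ENNReal.ofReal s < f x}.indicator 1 s) ∂μ :=
        lintegral_congr fun x => hpt (f x)
    _ = ∫⁻ s in Ioi (0 : ℝ), ∫⁻ x, {s : ℝ | ENNReal.ofReal s < f x}.indicator 1 s ∂μ :=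
        lintegral_lintegral_swap (μ := μ) (ν := volume.restrict (Ioi 0))
          (f := fun x s => {s : ℝ | ENNReal.ofReal s < f x}.indicator 1 s) hind.aemeasurable
    _ = ∫⁻ s in Ioi (0 : ℝ), μ {x | ENNReal.ofReal s < f x} := by
        refine lintegral_congr fun s => ?_
        rw [← lintegral_indicator_one (measurableSet_lt measurable_const hf)]
        rfl

/-- Among the subsets of `[p, ∞)` of given finite measure, an initial interval maximizes the
integral of an antitone weight. -/
theorem setLIntegral_le_setLIntegral_Ico {w : ℝ → ℝ≥0∞} (hw : Antitone w) {p : ℝ} {A : Set ℝ}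
    (hA : MeasurableSet A) (hpA : A ⊆ Ici p) (hfin : volume A ≠ ∞) :
    ∫⁻ x in A, w x ≤ ∫⁻ x in Ico p (p + (volume A).toReal), w x := by
  set z := p + (volume A).toReal with hz
  set B := Ico p z with hB
  have hBm : MeasurableSet B := measurableSet_Ico
  have hvol : volume B = volume A := by
    rw [hB, Real.volume_Ico, hz, add_sub_cancel_left, ENNReal.ofReal_toReal hfin]
  have hdiff : volume (A \ B) = volume (B \ A) := by
    have h1 := measure_inter_add_sdiff (μ := volume) A hBm
    have h2 := measure_inter_add_sdiff (μ := volume) B hA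
    rw [inter_comm, hvol, ← h1, inter_comm] at h2
    exact ((ENNReal.add_right_inj (measure_ne_top_of_subset inter_subset_right hfin)).1 h2).symm
  rw [← lintegral_inter_add_sdiff w A hBm, ← lintegral_inter_add_sdiff w B hA, inter_comm B A]
  refine add_le_add le_rfl ?_
  calc ∫⁻ x in A \ B, w x ≤ ∫⁻ _ in A \ B, w z :=
        setLIntegral_mono' (hA.diff hBm) fun x hx => hw (by
          by_contra! h
          exact hx.2 ⟨hpA hx.1, h⟩)
    _ = ∫⁻ _ in B \ A, w z := by rw [setLIntegral_const, setLIntegral_const, hdiff]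
    _ ≤ ∫⁻ x in B \ A, w x := setLIntegral_mono' (hBm.diff hA) fun x hx => hw hx.1.2.le

theorem setLIntegral_cell_le {w : ℝ → ℝ≥0∞} (hw : Antitone w) {δ : ℝ} (hδ : 0 < δ)
    {f : ℝ → ℝ≥0∞} (hf : Measurable f) (k : ℕ) :
    ∫⁻ x in Ico (k * δ) ((k + 1) * δ), f x * w x ≤
      ∫⁻ x in Ico (k * δ) ((k + 1) * δ), cellRearr δ f x * w x := by
  set μ := (volume.restrict (Ico (k * δ) ((k + 1) * δ))).withDensity w with hμ
  have hmul : ∀ {g : ℝ → ℝ≥0∞}, Measurable g →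
      ∫⁻ x in Ico (k * δ) ((k + 1) * δ), g x * w x =
        ∫⁻ s in Ioi (0 : ℝ), ∫⁻ x in {x | ENNReal.ofReal s < g x} ∩ Ico (k * δ) ((k + 1) * δ),
          w x := by
    intro g hg
    calc ∫⁻ x in Ico (k * δ) ((k + 1) * δ), g x * w x = ∫⁻ x, g x ∂μ := by
          rw [hμ, lintegral_withDensity_eq_lintegral_mul _ hw.measurable hg]
          simp only [Pi.mul_apply, mul_comm]
      _ = _ := by
          rw [lintegral_eq_lintegral_measure_lt μ hg]
          refine lintegral_congr fun s => ?_
          have hm : MeasurableSet {x | ENNReal.ofReal s < g x} :=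
            measurableSet_lt measurable_const hg
          rw [hμ, withDensity_apply _ hm, Measure.restrict_restrict hm]
  rw [hmul hf, hmul (measurable_cellRearr δ f)]
  refine lintegral_mono fun s => ?_
  dsimp only
  rw [setOf_lt_cellRearr_inter hδ]
  exact setLIntegral_le_setLIntegral_Ico hw
    ((measurableSet_lt measurable_const hf).inter measurableSet_Ico)
    (fun x hx => hx.2.1) ((cellDistrib_le δ f k _).trans_lt ENNReal.ofReal_lt_top).ne

theorem weightedTail_add_le_cellRearr {w : ℝ → ℝ≥0∞} (hw : Antitone w) {δ : ℝ} (hδ : 0 < δ)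
    {f : ℝ → ℝ≥0∞} (hf : Measurable f) {t : ℝ} (ht : 0 ≤ t) :
    weightedTail w f (t + δ) ≤ weightedTail w (cellRearr δ f) t := by
  set m := ⌈t / δ⌉₊
  have h1 : t ≤ m * δ := (div_le_iff₀ hδ).1 (Nat.le_ceil _)
  have h2 : m * δ < t + δ := by
    have := Nat.ceil_lt_add_one (div_nonneg ht hδ.le)
    rw [← sub_lt_iff_lt_add, lt_div_iff₀ hδ] at this
    linarith
  calc weightedTail w f (t + δ) ≤ ∫⁻ x in Ici (m * δ), f x * w x :=
        lintegral_mono_set fun x hx => (h2.trans hx).le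
    _ ≤ ∫⁻ x in Ici (m * δ), cellRearr δ f x * w x := by
        rw [setLIntegral_Ici_eq_tsum _ _ hδ, setLIntegral_Ici_eq_tsum _ _ hδ]
        refine ENNReal.tsum_le_tsum fun k => ?_
        have := setLIntegral_cell_le hw hδ hf (m + k)
        push_cast at this
        rwa [add_mul, show ((m : ℝ) + k + 1) * δ = m * δ + (k + 1) * δ by ring] at this
    _ = ∫⁻ x in Ioi (m * δ), cellRearr δ f x * w x := by rw [restrict_Ioi_eq_restrict_Ici]
    _ ≤ weightedTail w (cellRearr δ f) t := lintegral_mono_set (Ioi_subset_Ioi h1)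

theorem N_weightedTail_le_of_antitone (X Y : RIBanachFunctionNorm) {w : ℝ → ℝ≥0∞}
    (hw : Antitone w) {C : ℝ≥0∞}
    (hC : ∀ f : ℝ → ℝ≥0∞, Measurable f → AntitoneOn f (Ioi 0) → X.N f < ∞ →
      Y.N (weightedTail w f) ≤ C * X.N f)
    {f : ℝ → ℝ≥0∞} (hf : Measurable f) (hfin : X.N f < ∞) :
    Y.N (weightedTail w f) ≤ 4 * C * X.N f := by
  have hpos : ∀ n : ℕ, (0 : ℝ) < 1 / ((n : ℝ) + 1) := fun n => Nat.one_div_pos_of_nat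
  have hanti : Antitone fun n : ℕ => 1 / ((n : ℝ) + 1) := fun i j h =>
    Nat.one_div_le_one_div h
  have hm : ∀ n : ℕ, Measurable fun t => weightedTail w f (t + 1 / ((n : ℝ) + 1)) := fun n =>
    (measurable_weightedTail w f).comp (measurable_id.add_const _)
  rw [Y.fatou (fun n t => weightedTail w f (t + 1 / ((n : ℝ) + 1))) _ hm
    (measurable_weightedTail w f)]
  · refine iSup_le fun n => ?_
    have hN : X.N (cellRearr (1 / ((n : ℝ) + 1)) f) = X.N f :=
      X.ri _ _ (measurable_cellRearr _ _) hf (distrib_cellRearr (hpos n) hf)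
    calc Y.N (fun t => weightedTail w f (t + 1 / ((n : ℝ) + 1)))
        ≤ Y.N (weightedTail w (cellRearr (1 / ((n : ℝ) + 1)) f)) := by
          refine Y.mono _ _ (hm n) (measurable_weightedTail _ _) ?_
          filter_upwards [ae_restrict_mem measurableSet_Ioi] with t ht
          exact weightedTail_add_le_cellRearr hw (hpos n) hf (le_of_lt ht)
      _ ≤ 4 * C * X.N (cellRearr (1 / ((n : ℝ) + 1)) f) :=
          N_weightedTail_le_of_lowerSemicontinuous X Y hw.measurable
            (fun ε hε c n hc h => N_weightedTail_stepFun_le X Y hw hC hε hc h)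
            (measurable_cellRearr _ _) (ae_lowerSemicontinuousAt_cellRearr (hpos n) f)
            (by rwa [hN])
      _ = 4 * C * X.N f := by rw [hN]
  · exact Eventually.of_forall fun t i j hij =>
      antitone_weightedTail w f (add_le_add_right (hanti hij) t)
  · refine Eventually.of_forall fun t => ?_
    have hU : Ioi t = ⋃ n : ℕ, Ioi (t + 1 / ((n : ℝ) + 1)) := by
      ext x
      simp only [mem_Ioi, mem_iUnion]
      constructor
      · intro hx
        obtain ⟨n, hn⟩ := exists_nat_one_div_lt (sub_pos.2 hx)
        exact ⟨n, by linarith⟩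
      · rintro ⟨n, hn⟩
        linarith [hpos n]
    have hdir : Directed (· ⊆ ·) fun n : ℕ => Ioi (t + 1 / ((n : ℝ) + 1)) :=
      directed_of_isDirected_le fun i j hij => Ioi_subset_Ioi (add_le_add_right (hanti hij) t)
    unfold weightedTail
    rw [hU, setLIntegral_iUnion_of_directed _ hdir]

/-- The weight `1 / I` on `(0, ∞)`, extended by `∞` to the rest of the line. -/
def recipWeight (I : ℝ → ℝ) (s : ℝ) : ℝ≥0∞ := if 0 < s then (ENNReal.ofReal (I s))⁻¹ else ∞

theorem antitone_recipWeight {I : ℝ → ℝ} (hI : MonotoneOn I (Ioi 0)) :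
    Antitone (recipWeight I) := by
  intro s t hst
  unfold recipWeight
  split_ifs with h1 h2 h2
  · exact ENNReal.inv_le_inv.2 (ENNReal.ofReal_le_ofReal (hI h2 h1 hst))
  · exact le_top
  · exact absurd (h2.trans_le hst) h1
  · exact le_rfl

theorem measurable_HI (I : ℝ → ℝ) (f : ℝ → ℝ≥0∞) : Measurable (HI I f) :=
  Antitone.measurable fun _ _ h => lintegral_mono_set (Ioi_subset_Ioi h)

theorem BanachFunctionNorm.N_HI (Y : BanachFunctionNorm) (I : ℝ → ℝ) (f : ℝ → ℝ≥0∞) :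
    Y.N (HI I f) = Y.N (weightedTail (recipWeight I) f) := by
  refine Y.N_congr_ae (measurable_HI I f) (measurable_weightedTail _ _) ?_
  filter_upwards [ae_restrict_mem measurableSet_Ioi] with t ht
  refine setLIntegral_congr_fun measurableSet_Ioi fun s hs => ?_
  have hs0 : 0 < s := lt_trans ht hs
  simp only [recipWeight, if_pos hs0, div_eq_mul_inv]

/-- Theorem: reduction principle for `f ↦ ∫_t^∞ f(s)/I(s) ds`. -/
theorem statement0 (I : ℝ → ℝ) (hI : MonotoneOn I (Set.Ioi 0))
    (hIpos : ∀ t ∈ Set.Ioi (0 : ℝ), 0 < I t)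
    (X Y : RIBanachFunctionNorm) :
    ((∃ C : ℝ≥0, ∀ f : ℝ → ℝ≥0∞, Measurable f → X.N f < ∞ →
        Y.N (HI I f) ≤ (C : ℝ≥0∞) * X.N f) ↔
      (∃ C' : ℝ≥0, ∀ f : ℝ → ℝ≥0∞, Measurable f → AntitoneOn f (Set.Ioi 0) →
        X.N f < ∞ → Y.N (HI I f) ≤ (C' : ℝ≥0∞) * X.N f)) ∧
    ∀ C' : ℝ≥0,
      (∀ f : ℝ → ℝ≥0∞, Measurable f → AntitoneOn f (Set.Ioi 0) → X.N f < ∞ →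
        Y.N (HI I f) ≤ (C' : ℝ≥0∞) * X.N f) →
      ∀ f : ℝ → ℝ≥0∞, Measurable f → X.N f < ∞ →
        Y.N (HI I f) ≤ 4 * (C' : ℝ≥0∞) * X.N f := by
  have main : ∀ C' : ℝ≥0,
      (∀ f : ℝ → ℝ≥0∞, Measurable f → AntitoneOn f (Set.Ioi 0) → X.N f < ∞ →
        Y.N (HI I f) ≤ (C' : ℝ≥0∞) * X.N f) →
      ∀ f : ℝ → ℝ≥0∞, Measurable f → X.N f < ∞ →
        Y.N (HI I f) ≤ 4 * (C' : ℝ≥0∞) * X.N f := by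
    intro C' hC' f hf hfin
    simp only [Y.N_HI] at hC' ⊢
    exact N_weightedTail_le_of_antitone X Y (antitone_recipWeight hI) hC' hf hfin
  refine ⟨⟨fun ⟨C, hC⟩ => ⟨C, fun f hf _ hfin => hC f hf hfin⟩, fun ⟨C', hC'⟩ => ⟨4 * C', ?_⟩⟩, main⟩
  intro f hf hfin
  simpa using main C' hC' f hf hfin
end
end

section
/- Let I : (0,∞) → (0,∞) be non-decreasing and m ∈ ℕ ∪ {0}. Then for every non-negative measurable f on (0,∞) and all 0 ≤ c ≤ d < ∞, one has (d − c) R_I^m f*(d) ≤ 2^{m+1} ∫_c^d R_I^m f*(t) dt. -/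
open MeasureTheory Set Filter
open scoped ENNReal NNReal Topology

noncomputable section

/-- The rearrangement is non-increasing. -/
lemma rearr_antitone (f : ℝ → ℝ≥0∞) : Antitone (rearr f) := fun _ _ hst =>
  sInf_le_sInf fun _ hs => le_trans hs (ENNReal.ofReal_le_ofReal hst)

lemma lintegral_Ioc_two_mul (g : ℝ → ℝ≥0∞) (t : ℝ) :
    ∫⁻ s in Set.Ioc 0 (2 * t), g s = 2 * ∫⁻ s in Set.Ioc 0 t, g (2 * s) := by
  have he : MeasurableEmbedding fun x : ℝ => 2 * x :=
    (Homeomorph.mulLeft₀ (2 : ℝ) two_ne_zero).measurableEmbedding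
  have hv := Real.smul_map_volume_mul_left (two_ne_zero : (2 : ℝ) ≠ 0)
  have hpre : (fun x : ℝ => 2 * x) ⁻¹' Set.Ioc 0 (2 * t) = Set.Ioc 0 t := by
    ext x
    simp
  conv_lhs => rw [← hv]
  rw [Measure.restrict_smul, lintegral_smul_measure, he.restrict_map, he.lintegral_map, hpre]
  simp

/-- A pointwise doubling bound passes to primitives. -/
lemma lintegral_Ioc_two_mul_le {g : ℝ → ℝ≥0∞} {C : ℝ≥0∞} (hC : C ≠ ∞)
    (hg : ∀ t, 0 < t → g (2 * t) ≤ C * g t) (t : ℝ) :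
    ∫⁻ s in Set.Ioc 0 (2 * t), g s ≤ 2 * C * ∫⁻ s in Set.Ioc 0 t, g s := by
  rw [lintegral_Ioc_two_mul, mul_assoc, ← lintegral_const_mul' _ _ hC]
  gcongr 2 * ?_
  exact setLIntegral_mono' measurableSet_Ioc fun s hs => hg s hs.1

lemma RI_iterate_rearr_two_mul_le {I : ℝ → ℝ} (hI : MonotoneOn I (Set.Ioi 0)) (f : ℝ → ℝ≥0∞)
    (m : ℕ) (t : ℝ) (ht : 0 < t) :
    (RI I)^[m] (rearr f) (2 * t) ≤ 2 ^ m * (RI I)^[m] (rearr f) t := by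
  induction m generalizing t with
  | zero => simpa using rearr_antitone f (by linarith : t ≤ 2 * t)
  | succ m ih =>
    rw [Function.iterate_succ_apply']
    have hIt : I t ≤ I (2 * t) :=
      hI ht (show (0 : ℝ) < 2 * t by positivity) (by linarith)
    calc RI I ((RI I)^[m] (rearr f)) (2 * t)
        ≤ (2 * 2 ^ m * ∫⁻ s in Set.Ioc 0 t, (RI I)^[m] (rearr f) s) / ENNReal.ofReal (I t) :=
          ENNReal.div_le_div (lintegral_Ioc_two_mul_le (by simp) ih t)
            (ENNReal.ofReal_le_ofReal hIt)
      _ = 2 ^ (m + 1) * RI I ((RI I)^[m] (rearr f)) t := by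
          rw [RI, pow_succ', mul_div_assoc]


/-- `(d-c) R_I^m f*(d) ≤ 2^(m+1) ∫_c^d R_I^m f*(t) dt`. -/
theorem statement4 (I : ℝ → ℝ) (hI : MonotoneOn I (Set.Ioi 0))
    (hIpos : ∀ t ∈ Set.Ioi (0 : ℝ), 0 < I t)
    (m : ℕ) (f : ℝ → ℝ≥0∞) (hf : Measurable f) :
    ∀ c d : ℝ, 0 ≤ c → c ≤ d →
      ENNReal.ofReal (d - c) * (RI I)^[m] (rearr f) d ≤
        2 ^ (m + 1) * ∫⁻ t in Set.Ioc c d, (RI I)^[m] (rearr f) t := by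
  intro c d hc hcd
  rcases hcd.eq_or_lt with rfl | hlt
  · simp
  cases m with
  | zero =>
    calc ENNReal.ofReal (d - c) * rearr f d
        = ∫⁻ _ in Set.Ioc c d, rearr f d := by
          rw [setLIntegral_const, Real.volume_Ioc, mul_comm]
      _ ≤ ∫⁻ t in Set.Ioc c d, rearr f t :=
          setLIntegral_mono' measurableSet_Ioc fun t ht => rearr_antitone f ht.2
      _ ≤ 2 ^ (0 + 1) * ∫⁻ t in Set.Ioc c d, rearr f t :=
          le_mul_of_one_le_left' (by norm_num)
  | succ m =>
    rw [Function.iterate_succ_apply']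
    set g := (RI I)^[m] (rearr f)
    set e := (c + d) / 2 with he
    have hd : 0 < d := hc.trans_lt hlt
    have hG : ∫⁻ s in Set.Ioc 0 d, g s ≤ 2 * 2 ^ m * ∫⁻ s in Set.Ioc 0 e, g s := by
      calc ∫⁻ s in Set.Ioc 0 d, g s = ∫⁻ s in Set.Ioc 0 (2 * (d / 2)), g s := by
            rw [mul_div_cancel₀ d two_ne_zero]
        _ ≤ 2 * 2 ^ m * ∫⁻ s in Set.Ioc 0 (d / 2), g s :=
            lintegral_Ioc_two_mul_le (by simp) (RI_iterate_rearr_two_mul_le hI f m) _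
        _ ≤ 2 * 2 ^ m * ∫⁻ s in Set.Ioc 0 e, g s := by
            gcongr
            linarith
    have hlen : ENNReal.ofReal (d - c) = 2 * ENNReal.ofReal (d - e) := by
      rw [← ENNReal.ofReal_ofNat 2, ← ENNReal.ofReal_mul zero_le_two]
      congr 1
      rw [he]
      ring
    calc ENNReal.ofReal (d - c) * RI I g d
        ≤ 2 * ENNReal.ofReal (d - e) *
            ((2 * 2 ^ m * ∫⁻ s in Set.Ioc 0 e, g s) / ENNReal.ofReal (I d)) := by
          rw [hlen, RI]
          gcongr
      _ = 2 ^ (m + 1 + 1) *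
            ∫⁻ _ in Set.Ioc e d, (∫⁻ s in Set.Ioc 0 e, g s) / ENNReal.ofReal (I d) := by
          rw [setLIntegral_const, Real.volume_Ioc, mul_div_assoc]
          ring
      _ ≤ 2 ^ (m + 1 + 1) * ∫⁻ t in Set.Ioc e d, RI I g t := by
          gcongr 2 ^ (m + 1 + 1) * ?_
          refine setLIntegral_mono' measurableSet_Ioc fun t ht => ?_
          have ht0 : 0 < t := lt_trans (by rw [he]; linarith) ht.1
          exact ENNReal.div_le_div (lintegral_mono_set (Set.Ioc_subset_Ioc_right ht.1.le))
            (ENNReal.ofReal_le_ofReal (hI ht0 hd ht.2))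
      _ ≤ 2 ^ (m + 1 + 1) * ∫⁻ t in Set.Ioc c d, RI I g t := by
          gcongr
          linarith
end
end

section
/- Let m ∈ ℕ, let I : (0,∞) → (0,∞) be non-decreasing, and let I₀ : (0,∞) → (0,∞) be the non-decreasing left-continuous function that coincides with I almost everywhere on (0,∞). Then for every non-negative measurable f on (0,∞) there exists an at most countable set M ⊆ (0,∞) such that G_I^m f(t) = G_{I₀}^m f(t) for all t ∈ (0,∞) \ M; in particular G_I^m f = G_{I₀}^m f λ-a.e., and consequently ‖G_I^m f‖ = ‖G_{I₀}^m f‖ for any Banach function norm ‖·‖ on measurable functions on (0,∞). -/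
open MeasureTheory Set Filter
open scoped ENNReal NNReal Topology

noncomputable section

/-- A property holding a.e. on `(0,∞)` holds somewhere in every nondegenerate `(a,b) ⊆ (0,∞)`. -/
lemma exists_mem_Ioo_of_ae_Ioi {p : ℝ → Prop}
    (h : ∀ᵐ t ∂(volume.restrict (Set.Ioi (0 : ℝ))), p t) {a b : ℝ} (ha : 0 ≤ a) (hab : a < b) :
    ∃ r ∈ Set.Ioo a b, p r := by
  by_contra! hcon
  have hsub : Set.Ioo a b ⊆ Set.Ioi 0 := fun x hx => lt_of_le_of_lt ha hx.1
  have h' := ae_restrict_of_ae_restrict_of_subset hsub h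
  rw [ae_restrict_iff' measurableSet_Ioo] at h'
  have h0 : volume (Set.Ioo a b) = 0 :=
    measure_mono_null (fun x hx (hpx : x ∈ Set.Ioo a b → p x) => hcon x hx (hpx hx))
      (mem_ae_iff.mp h')
  rw [Real.volume_Ioo, ENNReal.ofReal_eq_zero] at h0
  linarith

lemma RI_iterate_ae_eq {I I₀ : ℝ → ℝ}
    (hae : ∀ᵐ t ∂(volume.restrict (Set.Ioi (0 : ℝ))), I t = I₀ t) (h : ℝ → ℝ≥0∞) (n : ℕ) :
    (RI I)^[n] h =ᵐ[volume.restrict (Set.Ioi (0 : ℝ))] (RI I₀)^[n] h := by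
  induction n with
  | zero => rfl
  | succ n ih =>
    rw [Function.iterate_succ_apply', Function.iterate_succ_apply']
    filter_upwards [hae] with t ht
    simp only [RI, ht]
    congr 1
    exact lintegral_congr_ae
      (ae_restrict_of_ae_restrict_of_subset (fun x hx => hx.1) ih)

lemma GI_antitone (I : ℝ → ℝ) (m : ℕ) (f : ℝ → ℝ≥0∞) : Antitone (GI I m f) :=
  fun _ _ hab => biSup_mono fun _ hs => le_trans hab hs

/-- A primitive is the supremum of its values along a strictly increasing sequence. -/
lemma setLIntegral_Ioc_eq_iSup (h : ℝ → ℝ≥0∞) {u : ℕ → ℝ} {a s : ℝ} (hu : StrictMono u)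
    (hus : ∀ n, u n < s) (hlim : Tendsto u atTop (𝓝 s)) :
    ∫⁻ x in Set.Ioc a s, h x = ⨆ n, ∫⁻ x in Set.Ioc a (u n), h x := by
  have hU : (⋃ n, Set.Ioc a (u n)) = Set.Ioo a s := by
    ext x
    simp only [Set.mem_iUnion, Set.mem_Ioc, Set.mem_Ioo]
    refine ⟨fun ⟨n, h1, h2⟩ => ⟨h1, h2.trans_lt (hus n)⟩, fun ⟨h1, h2⟩ => ?_⟩
    obtain ⟨n, hn⟩ := (hlim.eventually (lt_mem_nhds h2)).exists
    exact ⟨n, h1, hn.le⟩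
  have hd : Directed (· ⊆ ·) fun n => Set.Ioc a (u n) :=
    Monotone.directed_le fun i j hij => Set.Ioc_subset_Ioc_right (hu.monotone hij)
  rw [← setLIntegral_iUnion_of_directed h hd, hU]
  exact setLIntegral_congr Ioo_ae_eq_Ioc.symm

lemma le_of_ae_eq_of_leftContinuous {I I₀ : ℝ → ℝ} (hI : MonotoneOn I (Set.Ioi 0))
    (hI₀ : MonotoneOn I₀ (Set.Ioi 0))
    (hae : ∀ᵐ t ∂(volume.restrict (Set.Ioi (0 : ℝ))), I t = I₀ t) {s : ℝ} (hs : 0 < s)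
    (hlc : Tendsto I₀ (𝓝[<] s) (𝓝 (I₀ s))) : I₀ s ≤ I s := by
  refine le_of_tendsto hlc ?_
  filter_upwards [Ioo_mem_nhdsLT hs] with r hr
  obtain ⟨q, hq, hqe⟩ := exists_mem_Ioo_of_ae_Ioi hae hr.1.le hr.2
  have hq0 : 0 < q := hr.1.trans hq.1
  calc I₀ r ≤ I₀ q := hI₀ hr.1 hq0 hq.1.le
    _ = I q := hqe.symm
    _ ≤ I s := hI hq0 hs hq.2.le

/-- Monotone functions that are a.e. equal on `(0,∞)`, one of them left-continuous, differ at
most on a countable set. -/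
lemma countable_ne_of_ae_eq_of_leftContinuous {I I₀ : ℝ → ℝ} (hI : MonotoneOn I (Set.Ioi 0))
    (hI₀ : MonotoneOn I₀ (Set.Ioi 0))
    (hI₀lc : ∀ t ∈ Set.Ioi (0 : ℝ), Tendsto I₀ (𝓝[<] t) (𝓝 (I₀ t)))
    (hae : ∀ᵐ t ∂(volume.restrict (Set.Ioi (0 : ℝ))), I t = I₀ t) :
    {t | t ∈ Set.Ioi (0 : ℝ) ∧ I t ≠ I₀ t}.Countable := by
  refine Set.Countable.mono ?_ hI.countable_not_continuousWithinAt
  intro t ht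
  refine ⟨ht.1, fun hc => ht.2 ?_⟩
  have ht0 : 0 < t := ht.1
  have hlim : Tendsto I (𝓝[<] t) (𝓝 (I t)) :=
    (hc.continuousAt (Ioi_mem_nhds ht0)).tendsto.mono_left nhdsWithin_le_nhds
  exact le_antisymm
    (le_of_ae_eq_of_leftContinuous hI₀ hI (hae.mono fun _ h => h.symm) ht0 hlim)
    (le_of_ae_eq_of_leftContinuous hI hI₀ hae ht0 (hI₀lc t ht0))

lemma GI_succ_eq_of_eq {I I₀ : ℝ → ℝ} (hI : MonotoneOn I (Set.Ioi 0))
    (hI₀ : MonotoneOn I₀ (Set.Ioi 0))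
    (hI₀lc : ∀ t ∈ Set.Ioi (0 : ℝ), Tendsto I₀ (𝓝[<] t) (𝓝 (I₀ t)))
    (hae : ∀ᵐ t ∂(volume.restrict (Set.Ioi (0 : ℝ))), I t = I₀ t) (n : ℕ) (f : ℝ → ℝ≥0∞)
    {t : ℝ} (ht : 0 < t) (hIt : I t = I₀ t) : GI I (n + 1) f t = GI I₀ (n + 1) f t := by
  set h := (RI I₀)^[n] (rearr f)
  have hval₀ : ∀ s, (RI I₀)^[n + 1] (rearr f) s = RI I₀ h s := fun s => by
    rw [Function.iterate_succ_apply']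
  have hval : ∀ s, (RI I)^[n + 1] (rearr f) s = RI I h s := fun s => by
    rw [Function.iterate_succ_apply']
    simp only [RI]
    congr 1
    exact lintegral_congr_ae (ae_restrict_of_ae_restrict_of_subset
      (fun x hx => hx.1) (RI_iterate_ae_eq hae (rearr f) n))
  simp only [GI, hval, hval₀]
  refine le_antisymm (iSup₂_mono fun s hs => ?_) (iSup₂_le fun s hs => ?_)
  · have hs0 : 0 < s := ht.trans_le hs
    exact ENNReal.div_le_div_left (ENNReal.ofReal_le_ofReal
      (le_of_ae_eq_of_leftContinuous hI hI₀ hae hs0 (hI₀lc s hs0))) _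
  · rcases eq_or_lt_of_le (show t ≤ s from hs) with rfl | hts
    · refine le_trans (le_of_eq ?_) (le_iSup₂ (f := fun s _ => RI I h s) t hs)
      simp only [RI, hIt]
    · obtain ⟨u, hu, hus, hlim⟩ := exists_seq_strictMono_tendsto' hts
      change (∫⁻ x in Set.Ioc (0 : ℝ) s, h x) / ENNReal.ofReal (I₀ s) ≤ _
      rw [setLIntegral_Ioc_eq_iSup h hu (fun k => (hus k).2) hlim, ENNReal.iSup_div]
      refine iSup_le fun k => ?_
      have hk0 : 0 < u k := ht.trans (hus k).1
      obtain ⟨q, hq, hqe⟩ := exists_mem_Ioo_of_ae_Ioi hae hk0.le (hus k).2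
      have hq0 : 0 < q := hk0.trans hq.1
      refine le_trans ?_ (le_iSup₂ (f := fun s _ => RI I h s) q ((hus k).1.trans hq.1).le)
      simp only [RI, hqe]
      exact ENNReal.div_le_div
        (lintegral_mono_set (Set.Ioc_subset_Ioc_right hq.1.le))
        (ENNReal.ofReal_le_ofReal (hI₀ hq0 (ht.trans hts) hq.2.le))

lemma BanachFunctionNorm.congr_ae (X : BanachFunctionNorm) {f g : ℝ → ℝ≥0∞}
    (hf : Measurable f) (hg : Measurable g)
    (h : ∀ᵐ t ∂(volume.restrict (Set.Ioi (0 : ℝ))), f t = g t) : X.N f = X.N g :=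
  le_antisymm (X.mono f g hf hg (h.mono fun _ ht => ht.le))
    (X.mono g f hg hf (h.mono fun _ ht => ht.ge))

/-- replacing `I` with its left-continuous representative `I₀`
changes `G_I^m f` only on an at most countable set; consequently all Banach
function norms of `G_I^m f` and `G_{I₀}^m f` agree. -/
theorem statement5 (m : ℕ) (hm : 1 ≤ m) (I I₀ : ℝ → ℝ)
    (hI : MonotoneOn I (Set.Ioi 0))
    (hIpos : ∀ t ∈ Set.Ioi (0 : ℝ), 0 < I t)
    (hI₀ : MonotoneOn I₀ (Set.Ioi 0))
    (hI₀pos : ∀ t ∈ Set.Ioi (0 : ℝ), 0 < I₀ t)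
    (hI₀lc : ∀ t ∈ Set.Ioi (0 : ℝ), Filter.Tendsto I₀ (𝓝[<] t) (𝓝 (I₀ t)))
    (hae : ∀ᵐ t ∂(volume.restrict (Set.Ioi (0 : ℝ))), I t = I₀ t)
    (f : ℝ → ℝ≥0∞) (hf : Measurable f) :
    (∃ M : Set ℝ, M.Countable ∧ M ⊆ Set.Ioi (0 : ℝ) ∧
      ∀ t ∈ Set.Ioi (0 : ℝ) \ M, GI I m f t = GI I₀ m f t) ∧
    (∀ᵐ t ∂(volume.restrict (Set.Ioi (0 : ℝ))), GI I m f t = GI I₀ m f t) ∧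
    ∀ Nrm : BanachFunctionNorm, Nrm.N (GI I m f) = Nrm.N (GI I₀ m f) := by
  obtain ⟨n, rfl⟩ := Nat.exists_eq_add_of_le' hm
  have hcount := countable_ne_of_ae_eq_of_leftContinuous hI hI₀ hI₀lc hae
  have hEq : ∀ᵐ t ∂(volume.restrict (Set.Ioi (0 : ℝ))),
      GI I (n + 1) f t = GI I₀ (n + 1) f t := by
    filter_upwards [hae, ae_restrict_mem measurableSet_Ioi] with t ht ht0
    exact GI_succ_eq_of_eq hI hI₀ hI₀lc hae n f ht0 ht
  refine ⟨⟨_, hcount, fun t ht => ht.1, fun t ht => ?_⟩, hEq, fun Nrm => ?_⟩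
  · exact GI_succ_eq_of_eq hI hI₀ hI₀lc hae n f ht.1 (not_not.mp fun hne => ht.2 ⟨ht.1, hne⟩)
  · exact Nrm.congr_ae (GI_antitone I _ f).measurable (GI_antitone I₀ _ f).measurable hEq
end
end

section
/- Let I : (0,∞) → (0,∞) be non-decreasing and m ∈ ℕ. Then for every non-negative measurable f on (0,∞) and every t ∈ (0,∞), R_I^m f(t) = (1/(m−1)!) · (1/I(t)) · ∫_0^t f(s) (∫_s^t 1/I(r) dr)^{m−1} ds. -/
open MeasureTheory Set Filter
open scoped ENNReal NNReal Topology

noncomputable section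

lemma monotone_indicator_Ioi {I : ℝ → ℝ} (hI : MonotoneOn I (Ioi 0))
    (hIpos : ∀ t ∈ Ioi (0 : ℝ), 0 < I t) : Monotone ((Ioi (0 : ℝ)).indicator I) := by
  intro x y hxy
  by_cases hx : x ∈ Ioi (0 : ℝ)
  · have hy : y ∈ Ioi (0 : ℝ) := lt_of_lt_of_le hx hxy
    simpa [indicator_of_mem hx, indicator_of_mem hy] using hI hx hy hxy
  · rw [indicator_of_notMem hx]
    exact indicator_nonneg (fun t ht => (hIpos t ht).le) y

lemma intervalIntegrable_one_div {I : ℝ → ℝ} (hI : MonotoneOn I (Ioi 0))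
    (hIpos : ∀ t ∈ Ioi (0 : ℝ), 0 < I t) {s t : ℝ} (hs : 0 < s) (hst : s ≤ t) :
    IntervalIntegrable (fun r => 1 / I r) volume s t := by
  apply AntitoneOn.intervalIntegrable
  intro x hx y hy hxy
  rw [uIcc_of_le hst] at hx hy
  have hx0 : 0 < x := hs.trans_le hx.1
  exact one_div_le_one_div_of_le (hIpos x hx0) (hI hx0 (hx0.trans_le hxy) hxy)

lemma ofReal_integral_one_div {I : ℝ → ℝ} (hI : MonotoneOn I (Ioi 0))
    (hIpos : ∀ t ∈ Ioi (0 : ℝ), 0 < I t) {s t : ℝ} (hs : 0 < s) (hst : s ≤ t) :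
    ENNReal.ofReal (∫ r in s..t, 1 / I r) =
      ∫⁻ r in Ioc s t, (ENNReal.ofReal ((Ioi (0 : ℝ)).indicator I r))⁻¹ := by
  rw [intervalIntegral.integral_of_le hst, ofReal_integral_eq_lintegral_ofReal]
  · refine setLIntegral_congr_fun measurableSet_Ioc fun r hr => ?_
    have hr0 : r ∈ Ioi (0 : ℝ) := hs.trans hr.1
    simp only [indicator_of_mem hr0, one_div, ENNReal.ofReal_inv_of_pos (hIpos r hr0)]
  · exact (intervalIntegrable_iff_integrableOn_Ioc_of_le hst).1
      (intervalIntegrable_one_div hI hIpos hs hst)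
  · exact (ae_restrict_mem measurableSet_Ioc).mono fun r hr =>
      one_div_nonneg.2 (hIpos r (hs.trans hr.1)).le

lemma integral_primitive_pow_mul {I : ℝ → ℝ} (hI : MonotoneOn I (Ioi 0))
    (hIpos : ∀ t ∈ Ioi (0 : ℝ), 0 < I t) {s t : ℝ} (hs : 0 < s) (hst : s ≤ t) (n : ℕ) :
    IntervalIntegrable (fun u => (∫ r in s..u, 1 / I r) ^ n * (1 / I u)) volume s t ∧
    ∫ u in s..t, (∫ r in s..u, 1 / I r) ^ n * (1 / I u) =
      (∫ r in s..t, 1 / I r) ^ (n + 1) / (n + 1) := by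
  have hint := intervalIntegrable_one_div hI hIpos hs hst
  have hcont : ContinuousOn (fun u => ∫ r in s..u, 1 / I r) (uIcc s t) :=
    intervalIntegral.continuousOn_primitive_interval' hint left_mem_uIcc
  have hint' : IntervalIntegrable (fun u => (∫ r in s..u, 1 / I r) ^ n * (1 / I u))
      volume s t := hint.continuousOn_mul (hcont.pow n)
  refine ⟨hint', ?_⟩
  rw [MeasureTheory.integral_eq_of_hasDerivAt_off_countable_of_le
    (fun u => (∫ r in s..u, 1 / I r) ^ (n + 1) / (n + 1)) _ hst
    hI.countable_not_continuousWithinAt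
    (by rw [← uIcc_of_le hst]; exact (hcont.pow (n + 1)).div_const _) ?_ hint']
  · simp
  rintro x ⟨hx, hxc⟩
  have hx0 : 0 < x := hs.trans hx.1
  have hIx : ContinuousAt I x := by
    have : ContinuousWithinAt I (Ioi 0) x := by
      by_contra h
      exact hxc ⟨hx0, h⟩
    exact this.continuousAt (Ioi_mem_nhds hx0)
  have hmeas : StronglyMeasurableAtFilter (fun r => 1 / I r) (𝓝 x) := by
    refine ⟨Ioc s t, Ioc_mem_nhds hx.1 hx.2, ?_⟩
    exact ((intervalIntegrable_iff_integrableOn_Ioc_of_le hst).1 hint).aestronglyMeasurable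
  have hd := intervalIntegral.integral_hasDerivAt_right
    (intervalIntegrable_one_div hI hIpos hs hx.1.le) hmeas
    (continuousAt_const.div hIx (hIpos x hx0).ne')
  refine ((hd.pow (n + 1)).div_const ((n : ℝ) + 1)).congr_deriv ?_
  have : (n : ℝ) + 1 ≠ 0 := by positivity
  push_cast
  field_simp

lemma lintegral_primitive_pow_mul {I : ℝ → ℝ} (hI : MonotoneOn I (Ioi 0))
    (hIpos : ∀ t ∈ Ioi (0 : ℝ), 0 < I t) {s t : ℝ} (hs : 0 < s) (hst : s ≤ t) (n : ℕ) :
    ∫⁻ u in Ioc s t, ENNReal.ofReal (∫ r in s..u, 1 / I r) ^ n * (ENNReal.ofReal (I u))⁻¹ =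
      ((n + 1 : ℕ) : ℝ≥0∞)⁻¹ * ENNReal.ofReal (∫ r in s..t, 1 / I r) ^ (n + 1) := by
  obtain ⟨hint, heq⟩ := integral_primitive_pow_mul hI hIpos hs hst n
  have hnonneg : ∀ u, s ≤ u → 0 ≤ ∫ r in s..u, 1 / I r := fun u hu =>
    intervalIntegral.integral_nonneg hu fun r hr =>
      one_div_nonneg.2 (hIpos r (hs.trans_le hr.1)).le
  calc
    _ = ∫⁻ u in Ioc s t, ENNReal.ofReal ((∫ r in s..u, 1 / I r) ^ n * (1 / I u)) := by
      refine setLIntegral_congr_fun measurableSet_Ioc fun u hu => ?_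
      have hF := hnonneg u hu.1.le
      simp only [ENNReal.ofReal_mul (pow_nonneg hF n), ENNReal.ofReal_pow hF]
      rw [one_div (I u), ENNReal.ofReal_inv_of_pos (hIpos u (hs.trans hu.1))]
    _ = ENNReal.ofReal (∫ u in s..t, (∫ r in s..u, 1 / I r) ^ n * (1 / I u)) := by
      rw [intervalIntegral.integral_of_le hst, ofReal_integral_eq_lintegral_ofReal]
      · exact (intervalIntegrable_iff_integrableOn_Ioc_of_le hst).1 hint
      · exact (ae_restrict_mem measurableSet_Ioc).mono fun u hu =>
          mul_nonneg (pow_nonneg (hnonneg u hu.1.le) n)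
            (one_div_nonneg.2 (hIpos u (hs.trans hu.1)).le)
    _ = _ := by
      rw [heq, ENNReal.ofReal_div_of_pos (by positivity), ENNReal.ofReal_pow (hnonneg t hst),
        div_eq_mul_inv, mul_comm, ← Nat.cast_succ, ENNReal.ofReal_natCast]

/-- Tonelli's theorem on a triangle. -/
lemma lintegral_Ioc_Ioc_swap {F : ℝ → ℝ → ℝ≥0∞} (hF : Measurable (Function.uncurry F))
    (a t : ℝ) :
    ∫⁻ u in Ioc a t, ∫⁻ s in Ioc a u, F s u = ∫⁻ s in Ioc a t, ∫⁻ u in Ioc s t, F s u := by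
  let G : ℝ → ℝ → ℝ≥0∞ := fun u s =>
    {p : ℝ × ℝ | p.1 ≤ p.2}.indicator (Function.uncurry F) (s, u)
  have hG : Measurable (Function.uncurry G) :=
    (hF.indicator (measurableSet_le measurable_fst measurable_snd)).comp measurable_swap
  calc
    _ = ∫⁻ u in Ioc a t, ∫⁻ s in Ioc a t, G u s := by
      refine setLIntegral_congr_fun measurableSet_Ioc fun u hu => ?_
      have hGu : G u = (Iic u).indicator fun s => F s u := rfl
      simp only [hGu, lintegral_indicator measurableSet_Iic,
        Measure.restrict_restrict measurableSet_Iic]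
      congr 2
      ext s
      simp only [mem_Ioc, mem_inter_iff, mem_Iic]
      exact ⟨fun h => ⟨h.2, h.1, h.2.trans hu.2⟩, fun h => ⟨h.2.1, h.1⟩⟩
    _ = ∫⁻ s in Ioc a t, ∫⁻ u in Ioc a t, G u s := lintegral_lintegral_swap hG.aemeasurable
    _ = _ := by
      refine setLIntegral_congr_fun measurableSet_Ioc fun s hs => ?_
      have hGs : (fun u => G u s) = (Ici s).indicator fun u => F s u := rfl
      simp only [hGs, lintegral_indicator measurableSet_Ici,
        Measure.restrict_restrict measurableSet_Ici]
      rw [setLIntegral_congr (Ioc_ae_eq_Icc (a := s) (b := t))]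
      congr 2
      ext u
      simp only [mem_Ioc, mem_inter_iff, mem_Icc, mem_Ici]
      exact ⟨fun h => ⟨h.1, h.2.2⟩, fun h => ⟨h.1, hs.1.trans_le h.1, h.2⟩⟩

lemma measurable_setLIntegral_Ioc {w : ℝ → ℝ≥0∞} (hw : Measurable w) :
    Measurable fun p : ℝ × ℝ => ∫⁻ r in Ioc p.1 p.2, w r := by
  have hS : MeasurableSet {q : (ℝ × ℝ) × ℝ | q.2 ∈ Ioc q.1.1 q.1.2} :=
    (measurableSet_lt measurable_fst.fst measurable_snd).inter
      (measurableSet_le measurable_snd measurable_fst.snd)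
  have h := ((hw.comp measurable_snd).indicator hS).lintegral_prod_right' (ν := volume)
  simp only [← lintegral_indicator measurableSet_Ioc]
  exact h

lemma lintegral_lintegral_mul_pow_div {I : ℝ → ℝ} (hI : MonotoneOn I (Ioi 0))
    (hIpos : ∀ t ∈ Ioi (0 : ℝ), 0 < I t) {f : ℝ → ℝ≥0∞} (hf : Measurable f) (n : ℕ) (t : ℝ) :
    ∫⁻ u in Ioc 0 t, (∫⁻ s in Ioc 0 u, f s * ENNReal.ofReal (∫ r in s..u, 1 / I r) ^ n) /
        ENNReal.ofReal (I u) =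
      ((n + 1 : ℕ) : ℝ≥0∞)⁻¹ *
        ∫⁻ s in Ioc 0 t, f s * ENNReal.ofReal (∫ r in s..t, 1 / I r) ^ (n + 1) := by
  set w : ℝ → ℝ≥0∞ := fun r => (ENNReal.ofReal ((Ioi (0 : ℝ)).indicator I r))⁻¹ with hw_def
  have hw : Measurable w := (monotone_indicator_Ioi hI hIpos).measurable.ennreal_ofReal.inv
  have hw_eq : ∀ u, 0 < u → w u = (ENNReal.ofReal (I u))⁻¹ := fun u hu => by
    rw [hw_def]
    simp only [indicator_of_mem (show u ∈ Ioi (0 : ℝ) from hu)]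
  have hk := measurable_setLIntegral_Ioc hw
  calc
    _ = ∫⁻ u in Ioc 0 t, ∫⁻ s in Ioc 0 u, f s * ((∫⁻ r in Ioc s u, w r) ^ n * w u) := by
      refine setLIntegral_congr_fun measurableSet_Ioc fun u hu => ?_
      have hne : (ENNReal.ofReal (I u))⁻¹ ≠ ∞ := by simpa using hIpos u hu.1
      rw [div_eq_mul_inv, ← lintegral_mul_const' _ _ hne]
      refine setLIntegral_congr_fun measurableSet_Ioc fun s hs => ?_
      rw [ofReal_integral_one_div hI hIpos hs.1 hs.2, hw_eq u hu.1, mul_assoc]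
    _ = ∫⁻ s in Ioc 0 t, ∫⁻ u in Ioc s t, f s * ((∫⁻ r in Ioc s u, w r) ^ n * w u) :=
      lintegral_Ioc_Ioc_swap
        (F := fun s u => f s * ((∫⁻ r in Ioc s u, w r) ^ n * w u)) ((hf.comp measurable_fst).mul
        ((hk.pow_const n).mul (hw.comp measurable_snd))) 0 t
    _ = ∫⁻ s in Ioc 0 t, ((n + 1 : ℕ) : ℝ≥0∞)⁻¹ *
          (f s * ENNReal.ofReal (∫ r in s..t, 1 / I r) ^ (n + 1)) := by
      refine setLIntegral_congr_fun measurableSet_Ioc fun s hs => ?_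
      have hks : Measurable fun u => (∫⁻ r in Ioc s u, w r) ^ n * w u :=
        ((hk.comp (measurable_const.prodMk measurable_id)).pow_const n).mul hw
      rw [lintegral_const_mul _ hks, mul_left_comm, ← lintegral_primitive_pow_mul hI hIpos hs.1 hs.2 n]
      congr 1
      refine setLIntegral_congr_fun measurableSet_Ioc fun u hu => ?_
      rw [ofReal_integral_one_div hI hIpos hs.1 hu.1.le, hw_eq u (hs.1.trans hu.1)]
    _ = _ := lintegral_const_mul' _ _ (by simp)

/-- the closed formula for `R_I^m`. -/
theorem statement9 (I : ℝ → ℝ) (hI : MonotoneOn I (Set.Ioi 0))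
    (hIpos : ∀ t ∈ Set.Ioi (0 : ℝ), 0 < I t)
    (m : ℕ) (hm : 1 ≤ m) (f : ℝ → ℝ≥0∞) (hf : Measurable f) :
    ∀ t ∈ Set.Ioi (0 : ℝ),
      (RI I)^[m] f t = ((Nat.factorial (m - 1) : ℝ≥0∞))⁻¹ *
        ((∫⁻ s in Set.Ioc (0 : ℝ) t,
            f s * (ENNReal.ofReal (∫ r in s..t, 1 / I r)) ^ (m - 1)) /
          ENNReal.ofReal (I t)) := by
  obtain ⟨n, rfl⟩ := Nat.exists_eq_add_of_le' hm
  simp only [Nat.add_sub_cancel]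
  clear hm
  induction n with
  | zero => simp [RI]
  | succ n ih =>
    intro t _
    rw [Function.iterate_succ_apply', RI, setLIntegral_congr_fun measurableSet_Ioc
      (fun u hu => ih u hu.1), lintegral_const_mul' _ _ (by simp [Nat.factorial_ne_zero]),
      lintegral_lintegral_mul_pow_div hI hIpos hf n t, ← mul_assoc, mul_div_assoc,
      Nat.factorial_succ, Nat.cast_mul, ENNReal.mul_inv (by simp) (by simp),
      mul_comm (n.factorial : ℝ≥0∞)⁻¹]
end
end
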